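/- For every μ, ε > 0 there exists ν > 0 such that for every t ∈ ℕ there exists s ∈ ℕ with the following property: if 𝒜 is an ε-wicked reduced hypergraph with index set I, J ⊆ I has size at least s, and Φ, Ψ, Ω are (ν, 1/3+ε)-holes on J such that Φ and Ψ are ε-disjoint, then there exists a subset J⋆ ⊆ J of size at least t such that either (A) Φ ∪ Ω is a (μ, 1/3+ε)-hole on J⋆ that is ε-disjoint from Ψ, or (B) Ψ ∪ Ω is a (μ, 1/3+ε)-hole on J⋆ that is ε-disjoint from Φ. -/

import Mathlib

open Finset Classical

noncomputable section

/-- A reduced hypergraph: a finite (linearly ordered, here `ℕ`) index set `I`,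
pairwise disjoint nonempty finite vertex classes `P i j` for distinct `i j ∈ I`,
and for each triple of distinct indices a tripartite 3-uniform constituent,
encoded by a symmetric edge predicate on vertices. -/
structure ReducedHG where
  I : Finset ℕ
  P : ℕ → ℕ → Finset ℕ
  Psymm : ∀ i j, P i j = P j i
  Pnonempty : ∀ i j, i ∈ I → j ∈ I → i ≠ j → (P i j).Nonempty
  Pdisjoint : ∀ i j k l, i ≠ j → k ≠ l → ({i, j} : Finset ℕ) ≠ ({k, l} : Finset ℕ) →
      Disjoint (P i j) (P k l)
  Edge : ℕ → ℕ → ℕ → Prop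
  EdgeSymm : ∀ a b c, Edge a b c → Edge b a c
  EdgeSymm' : ∀ a b c, Edge a b c → Edge a c b
  EdgeValid : ∀ a b c, Edge a b c → ∃ i j k, i ∈ I ∧ j ∈ I ∧ k ∈ I ∧
      i ≠ j ∧ i ≠ k ∧ j ≠ k ∧ a ∈ P i j ∧ b ∈ P i k ∧ c ∈ P j k

namespace ReducedHG

variable (A : ReducedHG)

/-- The neighbourhood, inside the vertex class `P j k`, of two vertices `a`, `b`. -/
def nbhd (j k : ℕ) (a b : ℕ) : Finset ℕ := (A.P j k).filter fun c => A.Edge a b c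

/-- The number of crossing edges between three vertex sets. -/
def ecount (X Y Z : Finset ℕ) : ℕ :=
  ((X ×ˢ Y ×ˢ Z).filter fun t => A.Edge t.1 t.2.1 t.2.2).card

/-- `(d, ee)`-density: every pair of vertices sharing an index has large degree. -/
def EEDense (d : ℝ) : Prop :=
  ∀ i j k, i ∈ A.I → j ∈ A.I → k ∈ A.I → i ≠ j → i ≠ k → j ≠ k →
    ∀ a ∈ A.P i j, ∀ b ∈ A.P i k,
      d * ((A.P j k).card : ℝ) ≤ ((A.nbhd j k a b).card : ℝ)

/-- `(μ, vvv)`-density: every constituent has many edges. -/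
def VVVDense (μ : ℝ) : Prop :=
  ∀ i j k, i ∈ A.I → j ∈ A.I → k ∈ A.I → i ≠ j → i ≠ k → j ≠ k →
    μ * (((A.P i j).card : ℝ) * ((A.P i k).card : ℝ) * ((A.P j k).card : ℝ)) ≤
      (A.ecount (A.P i j) (A.P i k) (A.P j k) : ℝ)

/-- The reduced hypergraph supports a `K₅⁽³⁾`. -/
def SupportsK5 : Prop :=
  ∃ J ⊆ A.I, J.card = 5 ∧ ∃ f : ℕ → ℕ → ℕ,
    (∀ i ∈ J, ∀ j ∈ J, f i j = f j i) ∧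
    (∀ i ∈ J, ∀ j ∈ J, i ≠ j → f i j ∈ A.P i j) ∧
    (∀ i ∈ J, ∀ j ∈ J, ∀ k ∈ J, i ≠ j → i ≠ k → j ≠ k →
      A.Edge (f i j) (f i k) (f j k))

/-- `ε`-wicked: `(1/3 + ε, ee)`-dense and not supporting a `K₅⁽³⁾`. -/
def Wicked (ε : ℝ) : Prop := A.EEDense (1/3 + ε) ∧ ¬ A.SupportsK5

/-- A `J`-transversal: one vertex in each class `P i j`, `ij ∈ J⁽²⁾`. -/
def IsTransversal (J : Finset ℕ) (Q : ℕ → ℕ → ℕ) : Prop :=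
  (∀ i ∈ J, ∀ j ∈ J, Q i j = Q j i) ∧ ∀ i ∈ J, ∀ j ∈ J, i ≠ j → Q i j ∈ A.P i j

/-- A `(K, L)`-transversal: one vertex in each class `P k l`, `(k, l) ∈ K × L`. -/
def IsTransversal2 (K L : Finset ℕ) (Q : ℕ → ℕ → ℕ) : Prop :=
  ∀ k ∈ K, ∀ l ∈ L, Q k l ∈ A.P k l

/-- An inhabited triple of `J`-transversals. -/
def InhabitedTriple (J : Finset ℕ) (Q R S : ℕ → ℕ → ℕ) : Prop :=
  ∀ i ∈ J, ∀ j ∈ J, ∀ k ∈ J, i < j → j < k → A.Edge (Q i j) (R i k) (S j k)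

/-- An inhabited triple consisting of a `(K,L)`-, a `(K,M)`- and an `(L,M)`-transversal. -/
def InhabitedTriple2 (K L M : Finset ℕ) (Q R S : ℕ → ℕ → ℕ) : Prop :=
  ∀ k ∈ K, ∀ l ∈ L, ∀ m ∈ M, A.Edge (Q k l) (R k m) (S l m)

/-- `Φ` is a `μ`-hole on `J`. -/
def IsHole (μ : ℝ) (J : Finset ℕ) (Φ : Finset ℕ) : Prop :=
  (∀ i ∈ J, ∀ j ∈ J, i ≠ j → (Φ ∩ A.P i j).Nonempty) ∧
  ∀ i ∈ J, ∀ j ∈ J, ∀ k ∈ J, i ≠ j → i ≠ k → j ≠ k →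
    (A.ecount (Φ ∩ A.P i j) (Φ ∩ A.P i k) (Φ ∩ A.P j k) : ℝ) ≤
      μ * (((A.P i j).card : ℝ) * ((A.P i k).card : ℝ) * ((A.P j k).card : ℝ))

/-- `Φ` is a `(μ, ϑ)`-hole on `J` (a `μ`-hole of width at least `ϑ`). -/
def IsHoleW (μ ϑ : ℝ) (J : Finset ℕ) (Φ : Finset ℕ) : Prop :=
  A.IsHole μ J Φ ∧ ∀ i ∈ J, ∀ j ∈ J, i ≠ j →
    ϑ * ((A.P i j).card : ℝ) ≤ (((Φ ∩ A.P i j)).card : ℝ)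

/-- Two holes are `ε`-intersecting on `J`. -/
def HolesIntersecting (ε : ℝ) (J : Finset ℕ) (Φ Ψ : Finset ℕ) : Prop :=
  ∀ i ∈ J, ∀ j ∈ J, i ≠ j →
    ε * ((A.P i j).card : ℝ) ≤ ((Φ ∩ Ψ ∩ A.P i j).card : ℝ)

/-- Two holes are `ε`-disjoint on `J`. -/
def HolesDisjoint (ε : ℝ) (J : Finset ℕ) (Φ Ψ : Finset ℕ) : Prop :=
  ∀ i ∈ J, ∀ j ∈ J, i ≠ j →
    ((Φ ∩ Ψ ∩ A.P i j).card : ℝ) < ε * ((A.P i j).card : ℝ)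

/-- The link on `K` of the family `k ↦ f k`, where `f k` is a vertex in a class `P k ·`:
`⋃_{k ≠ k' ∈ K} N(f k, f k')`. -/
def link (K : Finset ℕ) (f : ℕ → ℕ) : Finset ℕ :=
  ((K ×ˢ K).filter fun p => p.1 ≠ p.2).biUnion fun p => A.nbhd p.1 p.2 (f p.1) (f p.2)

/-- The pair consisting of a transversal `T` on `Sh × B` and a transversal `U` on `Sh × C`
has `δ`-intersecting links. -/
def IntersectingLinks (δ : ℝ) (Sh B C : Finset ℕ) (T U : ℕ → ℕ → ℕ) : Prop :=
  ∀ a ∈ Sh, ∀ a' ∈ Sh, a ≠ a' → ∀ b ∈ B, ∀ c ∈ C,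
    δ * ((A.P a a').card : ℝ) ≤
      (((A.nbhd a a' (T a b) (T a' b)) ∩ (A.nbhd a a' (U a c) (U a' c))).card : ℝ)

/-- The pair consisting of a transversal `T` on `Sh × B` and a transversal `U` on `Sh × C`
has `δ`-disjoint links. -/
def DisjointLinks (δ : ℝ) (Sh B C : Finset ℕ) (T U : ℕ → ℕ → ℕ) : Prop :=
  ∀ a ∈ Sh, ∀ a' ∈ Sh, a ≠ a' → ∀ b ∈ B, ∀ c ∈ C,
    (((A.nbhd a a' (T a b) (T a' b)) ∩ (A.nbhd a a' (U a c) (U a' c))).card : ℝ) <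
      δ * ((A.P a a').card : ℝ)

/-- A bicolouring of the reduced hypergraph: both colours appear in every vertex class and
no edge is monochromatic. -/
def IsBicolouring (φ : ℕ → Bool) : Prop :=
  (∀ i ∈ A.I, ∀ j ∈ A.I, i ≠ j →
    (∃ v ∈ A.P i j, φ v = true) ∧ (∃ v ∈ A.P i j, φ v = false)) ∧
  ∀ a b c, A.Edge a b c → ¬ (φ a = φ b ∧ φ b = φ c)

/-- The minimum monochromatic codegree density is at least `x`: `τ₂(A, φ) ≥ x`. -/
def Tau2Ge (φ : ℕ → Bool) (x : ℝ) : Prop :=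
  ∀ i j k, i ∈ A.I → j ∈ A.I → k ∈ A.I → i ≠ j → i ≠ k → j ≠ k →
    ∀ a ∈ A.P i j, ∀ b ∈ A.P i k, φ a = φ b →
      x * ((A.P j k).card : ℝ) ≤ ((A.nbhd j k a b).card : ℝ)

/-- The `γ`-bad left cherries (both vertices in one hole, many neighbours outside
the other hole). -/
def badLeft (Φ Ψ : Finset ℕ) (γ : ℝ) (i j k : ℕ) : Finset (ℕ × ℕ) :=
  (A.P i j ×ˢ A.P i k).filter fun p =>
    (p.1 ∈ Φ ∧ p.2 ∈ Φ ∧ γ * ((A.P j k).card : ℝ) ≤ (((A.nbhd j k p.1 p.2) \ Ψ).card : ℝ)) ∨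
    (p.1 ∈ Ψ ∧ p.2 ∈ Ψ ∧ γ * ((A.P j k).card : ℝ) ≤ (((A.nbhd j k p.1 p.2) \ Φ).card : ℝ))

/-- The `γ`-bad middle cherries. -/
def badMid (Φ Ψ : Finset ℕ) (γ : ℝ) (i j k : ℕ) : Finset (ℕ × ℕ) :=
  (A.P i j ×ˢ A.P j k).filter fun p =>
    (p.1 ∈ Φ ∧ p.2 ∈ Φ ∧ γ * ((A.P i k).card : ℝ) ≤ (((A.nbhd i k p.1 p.2) \ Ψ).card : ℝ)) ∨
    (p.1 ∈ Ψ ∧ p.2 ∈ Ψ ∧ γ * ((A.P i k).card : ℝ) ≤ (((A.nbhd i k p.1 p.2) \ Φ).card : ℝ))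

/-- The `γ`-bad right cherries. -/
def badRight (Φ Ψ : Finset ℕ) (γ : ℝ) (i j k : ℕ) : Finset (ℕ × ℕ) :=
  (A.P i k ×ˢ A.P j k).filter fun p =>
    (p.1 ∈ Φ ∧ p.2 ∈ Φ ∧ γ * ((A.P i j).card : ℝ) ≤ (((A.nbhd i j p.1 p.2) \ Ψ).card : ℝ)) ∨
    (p.1 ∈ Ψ ∧ p.2 ∈ Ψ ∧ γ * ((A.P i j).card : ℝ) ≤ (((A.nbhd i j p.1 p.2) \ Φ).card : ℝ))

end ReducedHG


namespace AU

lemma ramsey1 {κ : Type} [Fintype κ] (t : ℕ) : ∃ s : ℕ, ∀ J : Finset ℕ, s ≤ J.card →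
    ∀ f : ℕ → κ, ∃ J' ⊆ J, t ≤ J'.card ∧ ∃ c, ∀ i ∈ J', f i = c := by
  refine ⟨Fintype.card κ * t, fun J hJ f => ?_⟩
  obtain ⟨y, -, hy⟩ := Finset.exists_le_card_fiber_of_mul_le_card_of_maps_to
    (s := J) (t := (Finset.univ : Finset κ)) (f := f) (n := t)
    (fun a _ => Finset.mem_univ _) ⟨f 0, Finset.mem_univ _⟩ (by simpa using hJ)
  exact ⟨_, Finset.filter_subset _ _, hy, y, fun i hi => (Finset.mem_filter.1 hi).2⟩

lemma ramsey2 {κ : Type} [Fintype κ] (t : ℕ) : ∃ s : ℕ, ∀ J : Finset ℕ, s ≤ J.card →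
    ∀ f : ℕ → ℕ → κ, ∃ J' ⊆ J, t ≤ J'.card ∧ ∃ c, ∀ i ∈ J', ∀ j ∈ J', i < j → f i j = c := by
  have key : ∀ u : ℕ, ∃ s : ℕ, ∀ J : Finset ℕ, s ≤ J.card → ∀ f : ℕ → ℕ → κ,
      ∃ J' ⊆ J, u ≤ J'.card ∧ ∃ g : ℕ → κ, ∀ i ∈ J', ∀ j ∈ J', i < j → f i j = g i := by
    intro u
    induction u with
    | zero => exact ⟨0, fun J _ f => ⟨∅, by simp, by simp, fun i => f i i, by simp⟩⟩
    | succ u ih =>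
      obtain ⟨s, hs⟩ := ih
      obtain ⟨s1, hs1⟩ := ramsey1 (κ := κ) s
      refine ⟨s1 + 1, fun J hJ f => ?_⟩
      have hne : J.Nonempty := Finset.card_pos.1 (by omega)
      set a := J.min' hne with ha
      obtain ⟨J1, hJ1, hc1, c, hc⟩ := hs1 (J.erase a)
        (by rw [Finset.card_erase_of_mem (J.min'_mem hne)]; omega) (f a)
      obtain ⟨J2, hJ2, hc2, g, hg⟩ := hs J1 hc1 f
      have hlt : ∀ j ∈ J2, a < j := fun j hj =>
        Finset.min'_lt_of_mem_erase_min' _ hne (hJ1 (hJ2 hj))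
      have han : a ∉ J2 := fun h => lt_irrefl _ (hlt a h)
      refine ⟨insert a J2, ?_, ?_, fun i => if i = a then c else g i, ?_⟩
      · intro x hx
        rcases Finset.mem_insert.1 hx with rfl | hx
        · exact J.min'_mem hne
        · exact Finset.mem_of_mem_erase (hJ1 (hJ2 hx))
      · rw [Finset.card_insert_of_notMem han]; omega
      · intro i hi j hj hij
        rcases Finset.mem_insert.1 hi with rfl | hi
        · rcases Finset.mem_insert.1 hj with rfl | hj
          · exact absurd hij (lt_irrefl _)
          · simpa using hc j (hJ2 hj)
        · have h1 := hlt i hi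
          have hia : i ≠ a := by omega
          rcases Finset.mem_insert.1 hj with rfl | hj
          · omega
          · simpa [hia] using hg i hi j hj hij
  obtain ⟨s1, hs1⟩ := ramsey1 (κ := κ) t
  obtain ⟨s, hs⟩ := key s1
  refine ⟨s, fun J hJ f => ?_⟩
  obtain ⟨J1, h1, h2, g, hg⟩ := hs J hJ f
  obtain ⟨J2, h3, h4, c, hc⟩ := hs1 J1 h2 g
  exact ⟨J2, h3.trans h1, h4, c, fun i hi j hj hij =>
    (hg i (h3 hi) j (h3 hj) hij).trans (hc i hi)⟩

lemma ramsey3 {κ : Type} [Fintype κ] (t : ℕ) : ∃ s : ℕ, ∀ J : Finset ℕ, s ≤ J.card →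
    ∀ f : ℕ → ℕ → ℕ → κ, ∃ J' ⊆ J, t ≤ J'.card ∧
      ∃ c, ∀ i ∈ J', ∀ j ∈ J', ∀ k ∈ J', i < j → j < k → f i j k = c := by
  have key : ∀ u : ℕ, ∃ s : ℕ, ∀ J : Finset ℕ, s ≤ J.card → ∀ f : ℕ → ℕ → ℕ → κ,
      ∃ J' ⊆ J, u ≤ J'.card ∧ ∃ g : ℕ → κ,
        ∀ i ∈ J', ∀ j ∈ J', ∀ k ∈ J', i < j → j < k → f i j k = g i := by
    intro u
    induction u with
    | zero => exact ⟨0, fun J _ f => ⟨∅, by simp, by simp, fun i => f i i i, by simp⟩⟩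
    | succ u ih =>
      obtain ⟨s, hs⟩ := ih
      obtain ⟨s1, hs1⟩ := ramsey2 (κ := κ) s
      refine ⟨s1 + 1, fun J hJ f => ?_⟩
      have hne : J.Nonempty := Finset.card_pos.1 (by omega)
      set a := J.min' hne with ha
      obtain ⟨J1, hJ1, hc1, c, hc⟩ := hs1 (J.erase a)
        (by rw [Finset.card_erase_of_mem (J.min'_mem hne)]; omega) (f a)
      obtain ⟨J2, hJ2, hc2, g, hg⟩ := hs J1 hc1 f
      have hlt : ∀ j ∈ J2, a < j := fun j hj =>
        Finset.min'_lt_of_mem_erase_min' _ hne (hJ1 (hJ2 hj))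
      have han : a ∉ J2 := fun h => lt_irrefl _ (hlt a h)
      refine ⟨insert a J2, ?_, ?_, fun i => if i = a then c else g i, ?_⟩
      · intro x hx
        rcases Finset.mem_insert.1 hx with rfl | hx
        · exact J.min'_mem hne
        · exact Finset.mem_of_mem_erase (hJ1 (hJ2 hx))
      · rw [Finset.card_insert_of_notMem han]; omega
      · intro i hi j hj k hk hij hjk
        have hle : ∀ x ∈ insert a J2, a ≤ x := by
          intro x hx
          rcases Finset.mem_insert.1 hx with rfl | hx
          · exact le_rfl
          · exact (hlt x hx).le
        have hi' := hle i hi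
        have hj2 : j ∈ J2 := by
          rcases Finset.mem_insert.1 hj with h | h
          · omega
          · exact h
        have hk2 : k ∈ J2 := by
          rcases Finset.mem_insert.1 hk with h | h
          · omega
          · exact h
        rcases Finset.mem_insert.1 hi with rfl | hi
        · simpa using hc j (hJ2 hj2) k (hJ2 hk2) hjk
        · have h1 := hlt i hi
          have hia : i ≠ a := by omega
          simpa [hia] using hg i hi j hj2 k hk2 hij hjk
  obtain ⟨s1, hs1⟩ := ramsey1 (κ := κ) t
  obtain ⟨s, hs⟩ := key s1
  refine ⟨s, fun J hJ f => ?_⟩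
  obtain ⟨J1, h1, h2, g, hg⟩ := hs J hJ f
  obtain ⟨J2, h3, h4, c, hc⟩ := hs1 J1 h2 g
  exact ⟨J2, h3.trans h1, h4, c, fun i hi j hj k hk hij hjk =>
    (hg i (h3 hi) j (h3 hj) k (h3 hk) hij hjk).trans (hc i hi)⟩

lemma splitBlock (a : ℕ) (J : Finset ℕ) (h : a ≤ J.card) :
    ∃ K ⊆ J, K.card = a ∧ ∀ x ∈ K, ∀ y ∈ J \ K, x < y := by
  induction a generalizing J with
  | zero => exact ⟨∅, by simp, by simp, by simp⟩
  | succ a ih =>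
    have hne : J.Nonempty := Finset.card_pos.1 (by omega)
    obtain ⟨K, hK, hc, hlt⟩ := ih (J.erase (J.min' hne))
      (by rw [Finset.card_erase_of_mem (J.min'_mem hne)]; omega)
    have hn : J.min' hne ∉ K := fun h => by simpa using hK h
    refine ⟨insert (J.min' hne) K, ?_, by rw [Finset.card_insert_of_notMem hn, hc], ?_⟩
    · intro x hx
      rcases Finset.mem_insert.1 hx with rfl | hx
      · exact J.min'_mem hne
      · exact Finset.mem_of_mem_erase (hK hx)
    · intro x hx y hy
      simp only [Finset.mem_sdiff, Finset.mem_insert, not_or] at hy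
      rcases Finset.mem_insert.1 hx with rfl | hx
      · exact lt_of_le_of_ne (Finset.min'_le _ _ hy.1) (Ne.symm hy.2.1)
      · exact hlt x hx y (by simp [hy])

lemma blocks (a b c : ℕ) (J : Finset ℕ) (h : a + b + c ≤ J.card) :
    ∃ K ⊆ J, ∃ L ⊆ J, ∃ M ⊆ J, K.card = a ∧ L.card = b ∧ M.card = c ∧
      (∀ k ∈ K, ∀ l ∈ L, k < l) ∧ (∀ k ∈ K, ∀ m ∈ M, k < m) ∧ (∀ l ∈ L, ∀ m ∈ M, l < m) := by
  obtain ⟨K, hK, hKc, hKl⟩ := splitBlock a J (by omega)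
  have h1 : (J \ K).card = J.card - a := by rw [Finset.card_sdiff_of_subset hK, hKc]
  obtain ⟨L, hL, hLc, hLl⟩ := splitBlock b (J \ K) (by omega)
  have h2 : ((J \ K) \ L).card = J.card - a - b := by
    rw [Finset.card_sdiff_of_subset hL, hLc, h1]
  obtain ⟨M, hM, hMc⟩ := Finset.exists_subset_card_eq (show c ≤ ((J \ K) \ L).card by omega)
  exact ⟨K, hK, L, hL.trans Finset.sdiff_subset, M,
    (hM.trans Finset.sdiff_subset).trans Finset.sdiff_subset, hKc, hLc, hMc,
    fun k hk l hl => hKl k hk l (hL hl),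
    fun k hk m hm => hKl k hk m (Finset.sdiff_subset (hM hm)),
    fun l hl m hm => hLl l hl m (hM hm)⟩

lemma cfp {α β : Type*} (X : Finset α) (Y : Finset β) (r : α → β → Prop) :
    (((X ×ˢ Y).filter (fun p => r p.1 p.2)).card : ℝ) =
      ∑ y ∈ Y, ((X.filter (fun x => r x y)).card : ℝ) := by
  simp only [Finset.card_filter, Finset.sum_product_right, Nat.cast_sum]

lemma cfp' {α β : Type*} (X : Finset α) (Y : Finset β) (r : α → β → Prop) :
    (((X ×ˢ Y).filter (fun p => r p.1 p.2)).card : ℝ) =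
      ∑ x ∈ X, ((Y.filter (fun y => r x y)).card : ℝ) := by
  simp only [Finset.card_filter, Finset.sum_product, Nat.cast_sum]

lemma avg {α β : Type*} (X : Finset α) (Y : Finset β) (r : α → β → Prop) (a b μ : ℝ)
    (ha : 0 < a) (hμ : 0 ≤ μ) (hX : (X.card : ℝ) ≤ a) (hY : (Y.card : ℝ) ≤ b)
    (h : μ * (a * b) ≤ (((X ×ˢ Y).filter (fun p => r p.1 p.2)).card : ℝ)) :
    μ / 2 * b ≤
      ((Y.filter (fun y => μ / 2 * a ≤ ((X.filter (fun x => r x y)).card : ℝ))).card : ℝ) := by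
  rw [cfp] at h
  set G := Y.filter (fun y => μ / 2 * a ≤ ((X.filter (fun x => r x y)).card : ℝ)) with hG
  have h1 : ∑ y ∈ Y, ((X.filter (fun x => r x y)).card : ℝ) ≤
      ∑ y ∈ Y, ((if μ / 2 * a ≤ ((X.filter (fun x => r x y)).card : ℝ) then a else 0)
        + μ / 2 * a) := by
    apply Finset.sum_le_sum
    intro y _
    have h0 : ((X.filter (fun x => r x y)).card : ℝ) ≤ a :=
      le_trans (by exact_mod_cast Finset.card_filter_le _ _) hX
    have h2 : 0 ≤ μ / 2 * a := by positivity
    split_ifs with hh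
    · linarith
    · push Not at hh; linarith
  rw [Finset.sum_add_distrib, ← Finset.sum_filter, Finset.sum_const, Finset.sum_const,
    nsmul_eq_mul, nsmul_eq_mul] at h1
  have h3 : (Y.card : ℝ) * (μ / 2 * a) ≤ b * (μ / 2 * a) :=
    mul_le_mul_of_nonneg_right hY (by positivity)
  have h4 : μ / 2 * b * a ≤ (G.card : ℝ) * a := by
    have := h.trans h1
    nlinarith
  exact le_of_mul_le_mul_right h4 ha

/-- some point is covered by many sets -/
lemma cover {α β : Type*} (X : Finset α) (Y : Finset β) (r : α → β → Prop) (c : ℝ)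
    (hY : Y.Nonempty)
    (h : ∀ x ∈ X, c * (Y.card : ℝ) ≤ ((Y.filter (fun y => r x y)).card : ℝ)) :
    ∃ y ∈ Y, c * (X.card : ℝ) ≤ ((X.filter (fun x => r x y)).card : ℝ) := by
  by_contra hcon
  push Not at hcon
  have h1 := Finset.sum_lt_sum_of_nonempty hY hcon
  rw [← cfp, cfp'] at h1
  have h2 := Finset.sum_le_sum h
  simp only [Finset.sum_const, nsmul_eq_mul] at h1 h2
  nlinarith

lemma pattern {α β : Type*} (K : Finset α) (L : Finset β) (r : α → β → Prop) (hK : K.Nonempty) :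
    ∃ k0 ∈ K, (K.card : ℝ) ≤ 2 ^ L.card *
      ((K.filter (fun k => ∀ l ∈ L, r k0 l → r k l)).card : ℝ) := by
  obtain ⟨y, hy, hy2⟩ := Finset.exists_max_image L.powerset
    (fun S => (K.filter (fun k => L.filter (fun l => r k l) = S)).card) ⟨∅, by simp⟩
  have h1 : K.card = ∑ S ∈ L.powerset, (K.filter (fun k => L.filter (fun l => r k l) = S)).card :=
    Finset.card_eq_sum_card_fiberwise
      (fun k _ => Finset.mem_coe.2 (Finset.mem_powerset.2 (Finset.filter_subset _ _)))
  have h2 : K.card ≤ L.powerset.card *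
      (K.filter (fun k => L.filter (fun l => r k l) = y)).card := by
    rw [h1]
    exact Finset.sum_le_card_nsmul _ _ _ hy2
  rw [Finset.card_powerset] at h2
  have hpos : 0 < K.card := Finset.card_pos.2 hK
  have hne : (K.filter (fun k => L.filter (fun l => r k l) = y)).Nonempty := by
    rw [← Finset.card_pos]
    by_contra h0
    have : (K.filter (fun k => L.filter (fun l => r k l) = y)).card = 0 := by omega
    rw [this] at h2; omega
  obtain ⟨k0, hk0⟩ := hne
  rw [Finset.mem_filter] at hk0
  refine ⟨k0, hk0.1, ?_⟩
  have h3 : (K.filter (fun k => L.filter (fun l => r k l) = y)).card ≤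
      (K.filter (fun k => ∀ l ∈ L, r k0 l → r k l)).card := by
    apply Finset.card_le_card
    intro k hk
    rw [Finset.mem_filter] at hk ⊢
    refine ⟨hk.1, fun l hl h => ?_⟩
    have : l ∈ L.filter (fun l => r k l) := by
      rw [hk.2, ← hk0.2]; simp [hl, h]
    exact (Finset.mem_filter.1 this).2
  calc (K.card : ℝ) ≤ ((2 ^ L.card * (K.filter (fun k => L.filter (fun l => r k l) = y)).card : ℕ) : ℝ) := by
        exact_mod_cast h2
    _ ≤ _ := by
        push_cast
        gcongr

/-- three big sets -/
lemma three (P X Y Z : Finset ℕ) (ε : ℝ) (hX : X ⊆ P) (hY : Y ⊆ P) (hZ : Z ⊆ P)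
    (h1 : (1/3 + ε) * (P.card : ℝ) ≤ X.card) (h2 : (1/3 + ε) * (P.card : ℝ) ≤ Y.card)
    (h3 : (1/3 + ε) * (P.card : ℝ) ≤ Z.card) :
    3 * ε * (P.card : ℝ) ≤ ((X ∩ Y).card : ℝ) + ((X ∩ Z).card : ℝ) + ((Y ∩ Z).card : ℝ) := by
  have a1 := Finset.card_union_add_card_inter X Y
  have a2 := Finset.card_union_add_card_inter (X ∪ Y) Z
  have a3 : ((X ∪ Y) ∩ Z).card ≤ (X ∩ Z).card + (Y ∩ Z).card := by
    rw [Finset.union_inter_distrib_right]; exact Finset.card_union_le _ _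
  have a4 : ((X ∪ Y) ∪ Z).card ≤ P.card :=
    Finset.card_le_card (Finset.union_subset (Finset.union_subset hX hY) hZ)
  have b1 : (((X ∪ Y).card : ℝ)) + (X ∩ Y).card = X.card + Y.card := by exact_mod_cast a1
  have b2 : (((X ∪ Y ∪ Z).card : ℝ)) + ((X ∪ Y) ∩ Z).card = (X ∪ Y).card + Z.card := by
    exact_mod_cast a2
  have b3 : (((X ∪ Y) ∩ Z).card : ℝ) ≤ (X ∩ Z).card + (Y ∩ Z).card := by exact_mod_cast a3
  have b4 : (((X ∪ Y) ∪ Z).card : ℝ) ≤ P.card := by exact_mod_cast a4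
  linarith

lemma pick {ι : Type*} (n : ℕ) : ∀ c : ℝ, 0 < c → ∃ ν : ℝ, 0 < ν ∧ ∀ (S : Finset ι),
    S.card ≤ n → ∀ (P X : ι → Finset ℕ),
    (∀ i ∈ S, (P i).Nonempty) → (∀ i ∈ S, X i ⊆ P i) →
    (∀ i ∈ S, c * ((P i).card : ℝ) ≤ ((X i).card : ℝ)) →
    ∀ B : ι → ι → ℕ → ℕ → Prop,
    (∀ i ∈ S, ∀ j ∈ S, i ≠ j →
      (((X i ×ˢ X j).filter (fun p => B i j p.1 p.2)).card : ℝ) ≤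
        ν * (((P i).card : ℝ) * ((P j).card : ℝ))) →
    ∃ f : ι → ℕ, (∀ i ∈ S, f i ∈ X i) ∧ ∀ i ∈ S, ∀ j ∈ S, i ≠ j → ¬ B i j (f i) (f j) := by
  induction n with
  | zero =>
    intro c hc
    refine ⟨1, one_pos, fun S hS P X _ _ _ B _ => ⟨fun _ => 0, ?_, ?_⟩⟩ <;>
    · have : S = ∅ := Finset.card_eq_zero.1 (by omega)
      subst this; simp
  | succ n ih =>
    intro c hc
    obtain ⟨ν0, hν0, h0⟩ := ih (c / 2) (by positivity)
    refine ⟨min ν0 (c ^ 2 / (8 * (n + 1))), lt_min hν0 (by positivity), ?_⟩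
    intro S hS P X hP hXP hX B hB
    set ν := min ν0 (c ^ 2 / (8 * ((n : ℝ) + 1))) with hν
    have hνpos : 0 < ν := lt_min hν0 (by positivity)
    rcases S.eq_empty_or_nonempty with rfl | ⟨i0, hi0⟩
    · exact ⟨fun _ => 0, by simp, by simp⟩
    set S' := S.erase i0 with hS'
    have hS'c : S'.card ≤ n := by
      rw [hS', Finset.card_erase_of_mem hi0]; omega
    have hPpos : ∀ i ∈ S, (0 : ℝ) < (P i).card := fun i hi => by
      exact_mod_cast Finset.card_pos.2 (hP i hi)
    obtain ⟨R, hR⟩ : ∃ R : ι → ℕ → ℕ → Prop,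
        ∀ j a b, R j a b ↔ (B i0 j a b ∨ B j i0 b a) := ⟨_, fun _ _ _ => Iff.rfl⟩
    let bad : ι → Finset ℕ := fun j => (X i0).filter
      (fun a => c / 2 * ((P j).card : ℝ) < (((X j).filter (fun b => R j a b)).card : ℝ))
    have hbad : ∀ j ∈ S', ((bad j).card : ℝ) ≤ 4 * ν / c * ((P i0).card : ℝ) := by
      intro j hj
      have hj' := Finset.mem_erase.1 hj
      have e1 : (((X i0 ×ˢ X j).filter (fun p => R j p.1 p.2)).card : ℝ) ≤
          2 * (ν * (((P i0).card : ℝ) * ((P j).card : ℝ))) := by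
        have u1 := hB i0 hi0 j hj'.2 (Ne.symm hj'.1)
        have u2 := hB j hj'.2 i0 hi0 hj'.1
        rw [cfp'] at u1
        rw [cfp] at u2
        rw [cfp']
        have : ∑ x ∈ X i0, (((X j).filter (fun y => R j x y)).card : ℝ) ≤
            ∑ x ∈ X i0, ((((X j).filter (fun y => B i0 j x y)).card : ℝ) +
              (((X j).filter (fun y => B j i0 y x)).card : ℝ)) := by
          apply Finset.sum_le_sum
          intro x _
          have : (X j).filter (fun y => R j x y) =
            (X j).filter (fun y => B i0 j x y) ∪ (X j).filter (fun y => B j i0 y x) := by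
            ext y; simp [hR, and_or_left]
          rw [this]
          exact_mod_cast Finset.card_union_le _ _
        rw [Finset.sum_add_distrib] at this
        have e : ν * (((P j).card : ℝ) * ((P i0).card : ℝ)) =
          ν * (((P i0).card : ℝ) * ((P j).card : ℝ)) := by ring
        linarith
      have e2 : ((bad j).card : ℝ) * (c / 2 * ((P j).card : ℝ)) ≤
          (((X i0 ×ˢ X j).filter (fun p => R j p.1 p.2)).card : ℝ) := by
        rw [cfp', ← nsmul_eq_mul]
        calc _ ≤ ∑ x ∈ bad j, (((X j).filter (fun y => R j x y)).card : ℝ) :=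
              Finset.card_nsmul_le_sum _ _ _ (fun x hx => (Finset.mem_filter.1 hx).2.le)
          _ ≤ _ := Finset.sum_le_sum_of_subset_of_nonneg (Finset.filter_subset _ _)
              (fun _ _ _ => by positivity)
      have hp := hPpos j hj'.2
      have e3 := e2.trans e1
      have e4 : ((bad j).card : ℝ) * c ≤ 4 * ν * (P i0).card := by
        have : ((bad j).card : ℝ) * c * (P j).card ≤ 4 * ν * (P i0).card * (P j).card := by
          nlinarith
        exact le_of_mul_le_mul_right this hp
      rw [div_mul_eq_mul_div, le_div_iff₀ hc]
      exact e4
    have hex : ∃ a ∈ X i0, ∀ j ∈ S', a ∉ bad j := by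
      by_contra hcon
      push Not at hcon
      have hsub : X i0 ⊆ S'.biUnion bad := fun a ha => by
        obtain ⟨j, hj, hj2⟩ := hcon a ha
        exact Finset.mem_biUnion.2 ⟨j, hj, hj2⟩
      have v1 : ((X i0).card : ℝ) ≤ ∑ j ∈ S', ((bad j).card : ℝ) := by
        exact_mod_cast (Finset.card_le_card hsub).trans Finset.card_biUnion_le
      have v2 := Finset.sum_le_card_nsmul S' (fun j => ((bad j).card : ℝ)) _ hbad
      rw [nsmul_eq_mul] at v2
      have v3 := hX i0 hi0
      have hp := hPpos i0 hi0
      have v4 : (S'.card : ℝ) * (4 * ν / c * ((P i0).card : ℝ)) ≤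
          (n : ℝ) * (4 * ν / c * ((P i0).card : ℝ)) := by
        have : (S'.card : ℝ) ≤ n := by exact_mod_cast hS'c
        gcongr
      have v5 : ν ≤ c ^ 2 / (8 * ((n : ℝ) + 1)) := min_le_right _ _
      have v6 : (n : ℝ) * (4 * ν / c) ≤ c / 2 := by
        rw [le_div_iff₀ (by positivity)] at v5
        rw [← mul_div_assoc, div_le_iff₀ hc]
        nlinarith
      nlinarith
    obtain ⟨a, haX, ha⟩ := hex
    let X' : ι → Finset ℕ := fun j => (X j).filter (fun b => ¬ R j a b)
    obtain ⟨f, hf1, hf2⟩ := h0 S' hS'c P X' (fun i hi => hP i (Finset.mem_of_mem_erase hi))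
      (fun i hi => (Finset.filter_subset _ _).trans (hXP i (Finset.mem_of_mem_erase hi)))
      (by
        intro j hj
        have w1 := ha j hj
        have w2 : (((X j).filter (fun b => R j a b)).card : ℝ) ≤ c / 2 * ((P j).card : ℝ) := by
          by_contra hh
          push Not at hh
          exact w1 (Finset.mem_filter.2 ⟨haX, hh⟩)
        have w3 := Finset.card_filter_add_card_filter_not (s := X j) (fun b => R j a b)
        have w4 : (((X j).filter (fun b => R j a b)).card : ℝ) + ((X' j).card : ℝ) =
          (X j).card := by exact_mod_cast w3
        have w5 := hX j (Finset.mem_of_mem_erase hj)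
        linarith)
      B (by
        intro i hi j hj hij
        have z1 := hB i (Finset.mem_of_mem_erase hi) j (Finset.mem_of_mem_erase hj) hij
        have z2 : (((X' i ×ˢ X' j).filter (fun p => B i j p.1 p.2)).card : ℝ) ≤
          (((X i ×ˢ X j).filter (fun p => B i j p.1 p.2)).card : ℝ) := by
          exact_mod_cast Finset.card_le_card (Finset.filter_subset_filter _
            (Finset.product_subset_product (Finset.filter_subset _ _) (Finset.filter_subset _ _)))
        have z3 : ν ≤ ν0 := min_le_left _ _
        have z4 : ν * (((P i).card : ℝ) * ((P j).card : ℝ)) ≤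
          ν0 * (((P i).card : ℝ) * ((P j).card : ℝ)) := by gcongr
        linarith)
    refine ⟨fun i => if i = i0 then a else f i, ?_, ?_⟩
    · intro i hi
      by_cases h : i = i0
      · subst h; simpa using haX
      · simp only [h, if_false]
        exact Finset.filter_subset _ _ (hf1 i (Finset.mem_erase.2 ⟨h, hi⟩))
    · intro i hi j hj hij
      by_cases h : i = i0
      · subst h
        have hj' : j ≠ i := Ne.symm hij
        have := (Finset.mem_filter.1 (hf1 j (Finset.mem_erase.2 ⟨hj', hj⟩))).2
        simp only [hj', if_false, if_true]
        exact fun hh => this ((hR _ _ _).2 (Or.inl hh))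
      · by_cases h2 : j = i0
        · subst h2
          have := (Finset.mem_filter.1 (hf1 i (Finset.mem_erase.2 ⟨h, hi⟩))).2
          simp only [h, if_false, if_true]
          exact fun hh => this ((hR _ _ _).2 (Or.inr hh))
        · simp only [h, h2, if_false]
          exact hf2 i (Finset.mem_erase.2 ⟨h, hi⟩) j (Finset.mem_erase.2 ⟨h2, hj⟩) hij

end AU

namespace AU

lemma K5mk (A : ReducedHG) (i : Fin 5 → ℕ) (hi : Function.Injective i) (hI : ∀ a, i a ∈ A.I)
    (v : Fin 5 → Fin 5 → ℕ) (hs : ∀ a b, v a b = v b a)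
    (hP : ∀ a b, a < b → v a b ∈ A.P (i a) (i b))
    (hE : ∀ a b c, a < b → b < c → A.Edge (v a b) (v a c) (v b c)) : A.SupportsK5 := by
  have hinv : ∀ a, Function.invFun i (i a) = a := Function.leftInverse_invFun hi
  have hP' : ∀ a b, a ≠ b → v a b ∈ A.P (i a) (i b) := by
    intro a b hab
    rcases lt_or_gt_of_ne hab with h | h
    · exact hP a b h
    · rw [hs, A.Psymm]; exact hP b a h
  have hE' : ∀ a b c, a ≠ b → a ≠ c → b ≠ c → A.Edge (v a b) (v a c) (v b c) := by
    intro a b c h1 h2 h3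
    rcases lt_or_gt_of_ne h1 with h1 | h1 <;> rcases lt_or_gt_of_ne h2 with h2 | h2 <;>
      rcases lt_or_gt_of_ne h3 with h3 | h3
    · exact hE a b c h1 h3
    · rw [hs b c]; exact A.EdgeSymm _ _ _ (hE a c b h2 h3)
    · exact absurd (h1.trans h3) (not_lt.2 h2.le)
    · rw [hs a c, hs b c]
      exact A.EdgeSymm _ _ _ (A.EdgeSymm' _ _ _ (hE c a b h2 h1))
    · rw [hs a b]; exact A.EdgeSymm' _ _ _ (hE b a c h1 h2)
    · exact absurd (h2.trans h3) (not_lt.2 h1.le)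
    · rw [hs a b, hs a c]
      exact A.EdgeSymm' _ _ _ (A.EdgeSymm _ _ _ (hE b c a h3 h2))
    · rw [hs a b, hs a c, hs b c]
      exact A.EdgeSymm _ _ _ (A.EdgeSymm' _ _ _ (A.EdgeSymm _ _ _ (hE c b a h3 h1)))
  refine ⟨Finset.univ.image i, ?_, ?_, fun x y => v (Function.invFun i x) (Function.invFun i y),
    ?_, ?_, ?_⟩
  · intro x hx
    obtain ⟨a, -, rfl⟩ := Finset.mem_image.1 hx
    exact hI a
  · rw [Finset.card_image_of_injective _ hi]; simp
  · intro x _ y _; exact hs _ _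
  · intro x hx y hy hxy
    obtain ⟨a, -, rfl⟩ := Finset.mem_image.1 hx
    obtain ⟨b, -, rfl⟩ := Finset.mem_image.1 hy
    simp only [hinv]
    exact hP' a b (fun h => hxy (by rw [h]))
  · intro x hx y hy z hz hxy hxz hyz
    obtain ⟨a, -, rfl⟩ := Finset.mem_image.1 hx
    obtain ⟨b, -, rfl⟩ := Finset.mem_image.1 hy
    obtain ⟨c, -, rfl⟩ := Finset.mem_image.1 hz
    simp only [hinv]
    exact hE' a b c (fun h => hxy (by rw [h])) (fun h => hxz (by rw [h]))
      (fun h => hyz (by rw [h]))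

lemma K5of (A : ReducedHG) (a b c d e : ℕ) (ha : a ∈ A.I) (hb : b ∈ A.I) (hc : c ∈ A.I)
    (hd : d ∈ A.I) (he : e ∈ A.I)
    (h1 : a ≠ b) (h2 : a ≠ c) (h3 : a ≠ d) (h4 : a ≠ e) (h5 : b ≠ c) (h6 : b ≠ d) (h7 : b ≠ e)
    (h8 : c ≠ d) (h9 : c ≠ e) (h10 : d ≠ e)
    (ab ac ad ae bc bd be cd ce de : ℕ)
    (mab : ab ∈ A.P a b) (mac : ac ∈ A.P a c) (mad : ad ∈ A.P a d) (mae : ae ∈ A.P a e)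
    (mbc : bc ∈ A.P b c) (mbd : bd ∈ A.P b d) (mbe : be ∈ A.P b e)
    (mcd : cd ∈ A.P c d) (mce : ce ∈ A.P c e) (mde : de ∈ A.P d e)
    (eabc : A.Edge ab ac bc) (eabd : A.Edge ab ad bd) (eabe : A.Edge ab ae be)
    (eacd : A.Edge ac ad cd) (eace : A.Edge ac ae ce) (eade : A.Edge ad ae de)
    (ebcd : A.Edge bc bd cd) (ebce : A.Edge bc be ce) (ebde : A.Edge bd be de)
    (ecde : A.Edge cd ce de) : A.SupportsK5 := by
  refine K5mk A ![a, b, c, d, e] ?_ ?_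
    ![![0, ab, ac, ad, ae], ![ab, 0, bc, bd, be], ![ac, bc, 0, cd, ce], ![ad, bd, cd, 0, de],
      ![ae, be, ce, de, 0]] ?_ ?_ ?_
  · intro x y
    fin_cases x <;> fin_cases y <;> simp [*, Ne.symm, eq_comm] 
  · intro x; fin_cases x <;> simpa
  · intro x y; fin_cases x <;> fin_cases y <;> rfl
  · intro x y h
    fin_cases x <;> fin_cases y <;> first | (exact absurd h (by decide)) | assumption
  · intro x y z h h'
    fin_cases x <;> fin_cases y <;> first
      | (exact absurd h (by decide))
      | (fin_cases z <;> first | (exact absurd h' (by decide)) | assumption)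

lemma nbhd_sub (A : ReducedHG) (j k a b : ℕ) : A.nbhd j k a b ⊆ A.P j k := Finset.filter_subset _ _

lemma mem_nbhd {A : ReducedHG} {j k a b c : ℕ} :
    c ∈ A.nbhd j k a b ↔ c ∈ A.P j k ∧ A.Edge a b c := by
  simp [ReducedHG.nbhd]

lemma nbhd_symm (A : ReducedHG) (j k a b : ℕ) : A.nbhd j k a b = A.nbhd k j b a := by
  ext c
  rw [mem_nbhd, mem_nbhd, A.Psymm j k]
  exact and_congr_right fun _ => ⟨A.EdgeSymm _ _ _, A.EdgeSymm _ _ _⟩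

lemma Ppos (A : ReducedHG) {i j : ℕ} (hi : i ∈ A.I) (hj : j ∈ A.I) (h : i ≠ j) :
    (0 : ℝ) < (A.P i j).card := by
  exact_mod_cast Finset.card_pos.2 (A.Pnonempty i j hi hj h)

lemma deg {A : ReducedHG} {ε : ℝ} (hA : A.EEDense (1/3 + ε)) {k k' l : ℕ} (hk : k ∈ A.I)
    (hk' : k' ∈ A.I) (hl : l ∈ A.I) (h1 : k ≠ k') (h2 : k ≠ l) (h3 : k' ≠ l) {x x' : ℕ}
    (hx : x ∈ A.P k l) (hx' : x' ∈ A.P k' l) :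
    (1/3 + ε) * ((A.P k k').card : ℝ) ≤ ((A.nbhd k k' x x').card : ℝ) :=
  hA l k k' hl hk hk' h2.symm h3.symm h1 x (by rw [A.Psymm]; exact hx) x'
    (by rw [A.Psymm]; exact hx')

lemma ecount_eq (A : ReducedHG) (X Y Z : Finset ℕ) :
    (A.ecount X Y Z : ℝ) = ∑ p ∈ X ×ˢ Y, ((Z.filter (fun z => A.Edge p.1 p.2 z)).card : ℝ) := by
  rw [← cfp' (X ×ˢ Y) Z (fun p z => A.Edge p.1 p.2 z)]
  norm_cast
  unfold ReducedHG.ecount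
  refine Finset.card_bij' (fun t _ => ((t.1, t.2.1), t.2.2)) (fun t _ => (t.1.1, t.1.2, t.2))
    ?_ ?_ ?_ ?_ <;> simp [and_assoc]

lemma ecount_assoc (A : ReducedHG) (X Y Z : Finset ℕ) :
    (A.ecount X Y Z : ℝ) =
      ((((X ×ˢ Y) ×ˢ Z).filter (fun p => A.Edge p.1.1 p.1.2 p.2)).card : ℝ) := by
  rw [ecount_eq, ← cfp' (X ×ˢ Y) Z (fun p z => A.Edge p.1 p.2 z)]

lemma ecount_213 (A : ReducedHG) (X Y Z : Finset ℕ) : A.ecount X Y Z = A.ecount Y X Z := by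
  unfold ReducedHG.ecount
  refine Finset.card_bij' (fun t _ => (t.2.1, t.1, t.2.2)) (fun t _ => (t.2.1, t.1, t.2.2))
    ?_ ?_ ?_ ?_
  · intro t ht; simp at ht ⊢; exact ⟨by tauto, A.EdgeSymm _ _ _ ht.2⟩
  · intro t ht; simp at ht ⊢; exact ⟨by tauto, A.EdgeSymm _ _ _ ht.2⟩
  · simp
  · simp

lemma ecount_132 (A : ReducedHG) (X Y Z : Finset ℕ) : A.ecount X Y Z = A.ecount X Z Y := by
  unfold ReducedHG.ecount
  refine Finset.card_bij' (fun t _ => (t.1, t.2.2, t.2.1)) (fun t _ => (t.1, t.2.2, t.2.1))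
    ?_ ?_ ?_ ?_
  · intro t ht; simp at ht ⊢; exact ⟨by tauto, A.EdgeSymm' _ _ _ ht.2⟩
  · intro t ht; simp at ht ⊢; exact ⟨by tauto, A.EdgeSymm' _ _ _ ht.2⟩
  · simp
  · simp

lemma ecount_mono (A : ReducedHG) {X Y Z X' Y' Z' : Finset ℕ} (hX : X ⊆ X') (hY : Y ⊆ Y')
    (hZ : Z ⊆ Z') : A.ecount X Y Z ≤ A.ecount X' Y' Z' :=
  Finset.card_le_card (Finset.filter_subset_filter _
    (Finset.product_subset_product hX (Finset.product_subset_product hY hZ)))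

lemma ecount_union (A : ReducedHG) (X X' Y Z : Finset ℕ) :
    A.ecount (X ∪ X') Y Z ≤ A.ecount X Y Z + A.ecount X' Y Z := by
  unfold ReducedHG.ecount
  rw [Finset.union_product, Finset.filter_union]
  exact Finset.card_union_le _ _

lemma ecount_lower (A : ReducedHG) (X Y Z : Finset ℕ) (d : ℝ)
    (h : ∀ x ∈ X, ∀ y ∈ Y, d ≤ ((Z.filter (fun z => A.Edge x y z)).card : ℝ)) :
    (X.card : ℝ) * Y.card * d ≤ A.ecount X Y Z := by
  rw [ecount_eq]
  have := Finset.card_nsmul_le_sum (X ×ˢ Y)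
    (fun p => ((Z.filter (fun z => A.Edge p.1 p.2 z)).card : ℝ)) d
    (fun p hp => h _ (Finset.mem_product.1 hp).1 _ (Finset.mem_product.1 hp).2)
  rw [nsmul_eq_mul, Finset.card_product] at this
  push_cast at this
  exact this

lemma IsHole.mono {A : ReducedHG} {ν ν' : ℝ} {J J' H : Finset ℕ} (h : A.IsHole ν J H)
    (hν : ν ≤ ν') (hJ : J' ⊆ J) : A.IsHole ν' J' H := by
  refine ⟨fun i hi j hj => h.1 i (hJ hi) j (hJ hj), fun i hi j hj k hk h1 h2 h3 => ?_⟩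
  refine (h.2 i (hJ hi) j (hJ hj) k (hJ hk) h1 h2 h3).trans ?_
  gcongr

lemma IsHoleW.mono {A : ReducedHG} {ν ν' w : ℝ} {J J' H : Finset ℕ} (h : A.IsHoleW ν w J H)
    (hν : ν ≤ ν') (hJ : J' ⊆ J) : A.IsHoleW ν' w J' H :=
  ⟨IsHole.mono h.1 hν hJ, fun i hi j hj => h.2 i (hJ hi) j (hJ hj)⟩

/-- many common neighbours of the pair in `H` -/
def bad (A : ReducedHG) (ε : ℝ) (H : Finset ℕ) (k k' x x' : ℕ) : Prop :=
  ε * ((A.P k k').card : ℝ) < ((A.nbhd k k' x x' ∩ H).card : ℝ)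

lemma hole_bad {A : ReducedHG} {ε ν : ℝ} (hε : 0 < ε) {J H : Finset ℕ} (hJ : J ⊆ A.I)
    (hH : A.IsHole ν J H)
    {k k' l : ℕ} (hk : k ∈ J) (hk' : k' ∈ J) (hl : l ∈ J) (h1 : k ≠ k') (h2 : k ≠ l) (h3 : k' ≠ l)
    {X X' : Finset ℕ} (hX : X ⊆ H ∩ A.P k l) (hX' : X' ⊆ H ∩ A.P k' l) :
    (((X ×ˢ X').filter (fun p => bad A ε H k k' p.1 p.2)).card : ℝ) ≤
      ν / ε * (((A.P k l).card : ℝ) * ((A.P k' l).card : ℝ)) := by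
  have e0 := hH.2 l hl k hk k' hk' h2.symm h3.symm h1
  set B := (X ×ˢ X').filter (fun p => bad A ε H k k' p.1 p.2) with hB
  have hp := Ppos A (hJ hk) (hJ hk') h1
  have e1 : (B.card : ℝ) * (ε * ((A.P k k').card : ℝ)) ≤
      (A.ecount (H ∩ A.P l k) (H ∩ A.P l k') (H ∩ A.P k k') : ℝ) := by
    rw [ecount_eq, ← nsmul_eq_mul]
    refine (Finset.card_nsmul_le_sum B (fun p => (((H ∩ A.P k k').filter
      (fun z => A.Edge p.1 p.2 z)).card : ℝ)) _ ?_).trans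
      (Finset.sum_le_sum_of_subset_of_nonneg ?_ (fun _ _ _ => by positivity))
    · intro p hp
      have h4 := (Finset.mem_filter.1 hp).2
      unfold bad at h4
      refine h4.le.trans ?_
      norm_cast
      apply Finset.card_le_card
      intro z hz
      rw [Finset.mem_inter, mem_nbhd] at hz
      rw [Finset.mem_filter, Finset.mem_inter]
      tauto
    · intro p hp
      have h4 := Finset.mem_product.1 (Finset.mem_filter.1 hp).1
      rw [Finset.mem_product, A.Psymm l k, A.Psymm l k']
      exact ⟨hX h4.1, hX' h4.2⟩
  rw [A.Psymm l k, A.Psymm l k'] at e0 e1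
  have e2 := e1.trans e0
  rw [div_mul_eq_mul_div, le_div_iff₀ hε]
  refine le_of_mul_le_mul_right ?_ hp
  linarith

lemma good_inter {A : ReducedHG} {ε ν : ℝ} (hA : A.EEDense (1/3 + ε)) {J H : Finset ℕ}
    (hJ : J ⊆ A.I) (hH : A.IsHoleW ν (1/3 + ε) J H)
    {k k' l m : ℕ} (hk : k ∈ J) (hk' : k' ∈ J) (hl : l ∈ J) (hm : m ∈ J)
    (h1 : k ≠ k') (h2 : k ≠ l) (h3 : k' ≠ l) (h4 : k ≠ m) (h5 : k' ≠ m)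
    {x x' y y' : ℕ} (hx : x ∈ A.P k l) (hx' : x' ∈ A.P k' l)
    (hy : y ∈ A.P k m) (hy' : y' ∈ A.P k' m)
    (g1 : ¬ bad A ε H k k' x x') (g2 : ¬ bad A ε H k k' y y') :
    ε * ((A.P k k').card : ℝ) ≤ ((A.nbhd k k' x x' ∩ A.nbhd k k' y y').card : ℝ) := by
  have d1 := deg hA (hJ hk) (hJ hk') (hJ hl) h1 h2 h3 hx hx'
  have d2 := deg hA (hJ hk) (hJ hk') (hJ hm) h1 h4 h5 hy hy'
  have d3 := hH.2 k hk k' hk' h1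
  have := three (A.P k k') _ _ _ ε (nbhd_sub A k k' x x') (nbhd_sub A k k' y y')
    (Finset.inter_subset_right (s₁ := H)) d1 d2 d3
  have u1 : ((A.nbhd k k' x x' ∩ (H ∩ A.P k k')).card : ℝ) ≤
      (A.nbhd k k' x x' ∩ H).card := by
    exact_mod_cast Finset.card_le_card
      (Finset.inter_subset_inter_left Finset.inter_subset_left)
  have u2 : ((A.nbhd k k' y y' ∩ (H ∩ A.P k k')).card : ℝ) ≤
      (A.nbhd k k' y y' ∩ H).card := by
    exact_mod_cast Finset.card_le_card
      (Finset.inter_subset_inter_left Finset.inter_subset_left)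
  unfold bad at g1 g2
  push Not at g1 g2
  linarith

/-- many large sets cannot be disjoint -/
lemma pigeon {α : Type*} (S : Finset α) (P : Finset ℕ) (hP : P.Nonempty) (F : α → Finset ℕ)
    (hF : ∀ a ∈ S, F a ⊆ P) (ε : ℝ) (hS : 1 < ε * (S.card : ℝ))
    (h : ∀ a ∈ S, ε * (P.card : ℝ) ≤ ((F a).card : ℝ)) :
    ∃ a ∈ S, ∃ b ∈ S, a ≠ b ∧ ∃ z ∈ F a, z ∈ F b := by
  by_contra hcon
  push Not at hcon
  have h1 : (S.biUnion F).card = ∑ a ∈ S, (F a).card := by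
    apply Finset.card_biUnion
    intro a ha b hb hab
    exact Finset.disjoint_left.2 (fun z hz hz' => hcon a ha b hb hab z hz hz')
  have h2 : (S.biUnion F).card ≤ P.card := Finset.card_le_card (Finset.biUnion_subset.2 hF)
  have h3 : ∑ a ∈ S, ((F a).card : ℝ) ≤ P.card := by
    rw [h1] at h2; exact_mod_cast h2
  have h4 := Finset.card_nsmul_le_sum S (fun a => ((F a).card : ℝ)) _ h
  rw [nsmul_eq_mul] at h4
  have h5 : (0 : ℝ) < P.card := by exact_mod_cast Finset.card_pos.2 hP
  nlinarith

end AU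

namespace AU

lemma avgE {α β : Type*} (X : Finset α) (Y : Finset β) (r : α → β → Prop) (a b μ : ℝ)
    (ha : 0 < a) (hμ : 0 ≤ μ) (hX : (X.card : ℝ) ≤ a) (hY : (Y.card : ℝ) ≤ b)
    (h : μ * (a * b) ≤ (((X ×ˢ Y).filter (fun p => r p.1 p.2)).card : ℝ)) :
    ∃ G ⊆ Y, μ / 2 * b ≤ (G.card : ℝ) ∧
      ∀ y ∈ G, μ / 2 * a ≤ ((X.filter (fun x => r x y)).card : ℝ) :=
  ⟨_, Finset.filter_subset _ _, avg X Y r a b μ ha hμ hX hY h, fun _ hy => (Finset.mem_filter.1 hy).2⟩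

lemma coverE {α β : Type*} (X : Finset α) (Y : Finset β) (r : α → β → Prop) (c : ℝ)
    (hY : Y.Nonempty)
    (h : ∀ x ∈ X, c * (Y.card : ℝ) ≤ ((Y.filter (fun y => r x y)).card : ℝ)) :
    ∃ y ∈ Y, ∃ X' ⊆ X, c * (X.card : ℝ) ≤ (X'.card : ℝ) ∧ ∀ x ∈ X', r x y := by
  obtain ⟨y, hy, h1⟩ := cover X Y r c hY h
  exact ⟨y, hy, _, Finset.filter_subset _ _, h1, fun _ hx => (Finset.mem_filter.1 hx).2⟩

lemma biq' {α β : Type*} (K : Finset α) (L : Finset β) (r : α → β → Prop) (c : ℝ)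
    (hK : K.Nonempty)
    (h : ∀ k ∈ K, c ≤ ((L.filter (fun l => r k l)).card : ℝ)) :
    ∃ K1 ⊆ K, ∃ L1 ⊆ L, (K.card : ℝ) ≤ 2 ^ L.card * (K1.card : ℝ) ∧ c ≤ (L1.card : ℝ) ∧
      ∀ k ∈ K1, ∀ l ∈ L1, r k l := by
  obtain ⟨k0, hk0, h1⟩ := pattern K L r hK
  refine ⟨_, Finset.filter_subset _ _, _, Finset.filter_subset _ _, h1, h k0 hk0, ?_⟩
  intro k hk l hl
  rw [Finset.mem_filter] at hk hl
  exact hk.2 l hl.1 hl.2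

lemma avgS {α β : Type*} (X : Finset α) (Y : Finset β) (r : α → β → Prop) (b μ : ℝ)
    (hX : X.Nonempty) (hμ : 0 ≤ μ) (hY : (Y.card : ℝ) ≤ b)
    (h : ∀ x ∈ X, ∃ Y' ⊆ Y, μ * b ≤ (Y'.card : ℝ) ∧ ∀ y ∈ Y', r x y) :
    ∃ G ⊆ Y, μ / 2 * b ≤ (G.card : ℝ) ∧
      ∀ y ∈ G, μ / 2 * (X.card : ℝ) ≤ ((X.filter (fun x => r x y)).card : ℝ) := by
  refine avgE X Y r X.card b μ (by exact_mod_cast Finset.card_pos.2 hX) hμ le_rfl hY ?_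
  rw [cfp']
  have h1 : ∀ x ∈ X, μ * b ≤ ((Y.filter (fun y => r x y)).card : ℝ) := by
    intro x hx
    obtain ⟨Y', h1, h2, h3⟩ := h x hx
    refine h2.trans ?_
    norm_cast
    exact Finset.card_le_card (fun y hy => Finset.mem_filter.2 ⟨h1 hy, h3 y hy⟩)
  have h2 := Finset.card_nsmul_le_sum X _ _ h1
  rw [nsmul_eq_mul] at h2
  linarith

lemma biq {α β : Type*} (K : Finset α) (L : Finset β) (r : α → β → Prop) (μ : ℝ) (hμ : 0 < μ)
    (hK : K.Nonempty) (hL : L.Nonempty)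
    (h : ∀ l ∈ L, ∃ K' ⊆ K, μ * (K.card : ℝ) ≤ (K'.card : ℝ) ∧ ∀ k ∈ K', r k l) :
    ∃ K1 ⊆ K, ∃ L1 ⊆ L, μ / 2 * (K.card : ℝ) ≤ 2 ^ L.card * (K1.card : ℝ) ∧
      μ / 2 * (L.card : ℝ) ≤ (L1.card : ℝ) ∧ ∀ k ∈ K1, ∀ l ∈ L1, r k l := by
  obtain ⟨G, hG, hG1, hG2⟩ := avgS L K (fun l k => r k l) K.card μ hL hμ.le le_rfl h
  have hKp : (0 : ℝ) < K.card := by exact_mod_cast Finset.card_pos.2 hK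
  have hGne : G.Nonempty := by
    rw [← Finset.card_pos]
    have : (0 : ℝ) < G.card := lt_of_lt_of_le (by positivity) hG1
    exact_mod_cast this
  obtain ⟨K1, h1, L1, h2, h3, h4, h5⟩ := biq' G L r _ hGne hG2
  exact ⟨K1, h1.trans hG, L1, h2, hG1.trans h3, h4, h5⟩

lemma ramsey2F {γ : Type*} (N t : ℕ) : ∃ s : ℕ, ∀ J : Finset ℕ, s ≤ J.card →
    ∀ (C : Finset γ), C.card ≤ N → ∀ f : ℕ → ℕ → γ,
    (∀ i ∈ J, ∀ j ∈ J, i < j → f i j ∈ C) →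
    ∃ J' ⊆ J, t ≤ J'.card ∧ ∀ i ∈ J', ∀ j ∈ J', ∀ i' ∈ J', ∀ j' ∈ J', i < j → i' < j' →
      f i j = f i' j' := by
  obtain ⟨s, hs⟩ := ramsey2 (κ := Fin (N + 1)) t
  refine ⟨s, fun J hJ C hC f hf => ?_⟩
  let e : γ → Fin (N + 1) := fun x =>
    if h : x ∈ C then Fin.castLE (hC.trans (Nat.le_succ N)) (C.equivFin ⟨x, h⟩) else 0
  have he : ∀ x ∈ C, ∀ y ∈ C, e x = e y → x = y := by
    intro x hx y hy hxy
    simp only [e, hx, hy, dif_pos, Fin.castLE_inj, EmbeddingLike.apply_eq_iff_eq,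
      Subtype.mk.injEq] at hxy
    exact hxy
  obtain ⟨J', h1, h2, c, hc⟩ := hs J hJ (fun i j => e (f i j))
  refine ⟨J', h1, h2, fun i hi j hj i' hi' j' hj' hij hij' => ?_⟩
  exact he _ (hf i (h1 hi) j (h1 hj) hij) _ (hf i' (h1 hi') j' (h1 hj') hij')
    ((hc i hi j hj hij).trans (hc i' hi' j' hj' hij').symm)

end AU

namespace AU

lemma exNat (c x : ℝ) (hc : 0 < c) : ∃ n : ℕ, x ≤ c * n := by
  obtain ⟨n, hn⟩ := exists_nat_ge (x / c)
  refine ⟨n, ?_⟩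
  rw [div_le_iff₀ hc] at hn
  linarith

/-- final stage of the core argument: from vertices to a `K5` -/
lemma core2 (ε : ℝ) (hε : 0 < ε) : ∃ T : ℕ, 0 < T ∧ ∀ nL : ℕ, ∃ s2 : ℕ,
    ∀ (A : ReducedHG) (m : ℕ) (K L : Finset ℕ),
    m ∈ A.I → K ⊆ A.I → L ⊆ A.I → (∀ k ∈ K, ∀ l ∈ L, k ≠ l) → m ∉ K → m ∉ L →
    T ≤ L.card → L.card ≤ nL → s2 ≤ K.card →
    ∀ (s r : ℕ → ℕ) (q : ℕ → ℕ → ℕ),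
    (∀ l ∈ L, s l ∈ A.P l m) → (∀ k ∈ K, r k ∈ A.P k m) →
    (∀ k ∈ K, ∀ l ∈ L, q k l ∈ A.P k l) →
    (∀ k ∈ K, ∀ l ∈ L, A.Edge (q k l) (r k) (s l)) →
    (∀ k ∈ K, ∀ k' ∈ K, k ≠ k' → ∀ l ∈ L, ε * ((A.P k k').card : ℝ) ≤
      ((A.nbhd k k' (q k l) (q k' l) ∩ A.nbhd k k' (r k) (r k')).card : ℝ)) →
    (∀ l ∈ L, ∀ l' ∈ L, l ≠ l' → ∀ k ∈ K, ε * ((A.P l l').card : ℝ) ≤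
      ((A.nbhd l l' (q k l) (q k l') ∩ A.nbhd l l' (s l) (s l')).card : ℝ)) →
    A.SupportsK5 := by
  obtain ⟨T0, hT0⟩ := exists_nat_gt (1 / ε)
  have hT : ∀ n : ℕ, T0 + 2 ≤ n → 1 < ε * (n : ℝ) := by
    intro n hn
    rw [div_lt_iff₀ hε] at hT0
    have : (T0 : ℝ) ≤ n := by exact_mod_cast (by omega : T0 ≤ n)
    nlinarith
  refine ⟨T0 + 2, by omega, fun nL => ?_⟩
  obtain ⟨s2, hs2⟩ := ramsey2F (γ := ℕ × ℕ) (nL * nL) (T0 + 2)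
  refine ⟨s2, ?_⟩
  intro A m K L hm hK hL hKL hmK hmL hLT hLn hKs s r q hs hr hq he h1 h2
  have step : ∀ k k', k ∈ K → k' ∈ K → k < k' → ∃ p : ℕ × ℕ, p ∈ L ×ˢ L ∧ p.1 ≠ p.2 ∧ ∃ z,
      z ∈ A.nbhd k k' (q k p.1) (q k' p.1) ∧ z ∈ A.nbhd k k' (q k p.2) (q k' p.2) ∧
      z ∈ A.nbhd k k' (r k) (r k') := by
    intro k k' hk hk' hkk'
    obtain ⟨l, hl, l', hl', hne, z, hz, hz'⟩ := pigeon L (A.P k k')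
      (A.Pnonempty _ _ (hK hk) (hK hk') hkk'.ne)
      (fun l => A.nbhd k k' (q k l) (q k' l) ∩ A.nbhd k k' (r k) (r k'))
      (fun l _ => Finset.inter_subset_left.trans (nbhd_sub _ _ _ _ _)) ε (hT _ hLT)
      (fun l hl => h1 k hk k' hk' hkk'.ne l hl)
    rw [Finset.mem_inter] at hz hz'
    exact ⟨(l, l'), Finset.mem_product.2 ⟨hl, hl'⟩, hne, z, hz.1, hz'.1, hz.2⟩
  choose! f hf1 hf2 hf3 using step
  obtain ⟨K3, hK3, hK3c, hc⟩ := hs2 K hKs (L ×ˢ L)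
    (by rw [Finset.card_product]; exact Nat.mul_le_mul hLn hLn) f
    (fun i hi j hj hij => hf1 i j hi hj hij)
  obtain ⟨i0, hi0, j0, hj0, hij0⟩ : ∃ i ∈ K3, ∃ j ∈ K3, i < j := by
    obtain ⟨a, b, ha, hb, hab⟩ := Finset.one_lt_card_iff.1 (by omega : 1 < K3.card)
    rcases lt_or_gt_of_ne hab with h | h
    · exact ⟨a, ha, b, hb, h⟩
    · exact ⟨b, hb, a, ha, h⟩
  set l := (f i0 j0).1 with hl_def
  set l' := (f i0 j0).2 with hl'_def
  have hL2 := Finset.mem_product.1 (hf1 i0 j0 (hK3 hi0) (hK3 hj0) hij0)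
  have hl : l ∈ L := hL2.1
  have hl' : l' ∈ L := hL2.2
  have hll' : l ≠ l' := hf2 i0 j0 (hK3 hi0) (hK3 hj0) hij0
  obtain ⟨a, ha, b, hb, hab, z', hza, hzb⟩ := pigeon K3 (A.P l l')
    (A.Pnonempty _ _ (hL hl) (hL hl') hll')
    (fun k => A.nbhd l l' (q k l) (q k l') ∩ A.nbhd l l' (s l) (s l'))
    (fun l _ => Finset.inter_subset_left.trans (nbhd_sub _ _ _ _ _)) ε (hT _ hK3c)
    (fun k hk => h2 l hl l' hl' hll' k (hK3 hk))
  obtain ⟨k, hk, k', hk', hkk', hzk, hzk'⟩ : ∃ k ∈ K3, ∃ k' ∈ K3, k < k' ∧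
      z' ∈ A.nbhd l l' (q k l) (q k l') ∩ A.nbhd l l' (s l) (s l') ∧
      z' ∈ A.nbhd l l' (q k' l) (q k' l') ∩ A.nbhd l l' (s l) (s l') := by
    rcases lt_or_gt_of_ne hab with h | h
    · exact ⟨a, ha, b, hb, h, hza, hzb⟩
    · exact ⟨b, hb, a, ha, h, hzb, hza⟩
  obtain ⟨z, hz1, hz2, hz3⟩ := hf3 k k' (hK3 hk) (hK3 hk') hkk'
  rw [hc k hk k' hk' i0 hi0 j0 hj0 hkk' hij0] at hz1 hz2
  change z ∈ A.nbhd k k' (q k l) (q k' l) at hz1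
  change z ∈ A.nbhd k k' (q k l') (q k' l') at hz2
  rw [Finset.mem_inter] at hzk hzk'
  rw [mem_nbhd] at hz1 hz2 hz3
  rw [mem_nbhd, mem_nbhd] at hzk hzk'
  have hkK := hK3 hk
  have hkK' := hK3 hk'
  exact K5of A k k' l l' m (hK hkK) (hK hkK') (hL hl) (hL hl') hm hkk'.ne
    (hKL k hkK l hl) (hKL k hkK l' hl') (fun h => hmK (h ▸ hkK))
    (hKL k' hkK' l hl) (hKL k' hkK' l' hl') (fun h => hmK (h ▸ hkK')) hll'
    (fun h => hmL (h ▸ hl)) (fun h => hmL (h ▸ hl'))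
    z (q k l) (q k l') (r k) (q k' l) (q k' l') (r k') z' (s l) (s l')
    hz1.1 (hq k hkK l hl) (hq k hkK l' hl') (hr k hkK) (hq k' hkK' l hl) (hq k' hkK' l' hl')
    (hr k' hkK') hzk.1.1 (hs l hl) (hs l' hl')
    (A.EdgeSymm _ _ _ (A.EdgeSymm' _ _ _ hz1.2)) (A.EdgeSymm _ _ _ (A.EdgeSymm' _ _ _ hz2.2))
    (A.EdgeSymm _ _ _ (A.EdgeSymm' _ _ _ hz3.2)) hzk.1.2 (he k hkK l hl) (he k hkK l' hl')
    hzk'.1.2 (he k' hkK' l hl) (he k' hkK' l' hl')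
    (A.EdgeSymm _ _ _ (A.EdgeSymm' _ _ _ hzk.2.2))

lemma core (ε μ1 : ℝ) (hε : 0 < ε) (hμ1 : 0 < μ1) : ∃ nL nK : ℕ, ∃ ν : ℝ, 0 < ν ∧
    ∀ (A : ReducedHG) (m : ℕ) (K L : Finset ℕ),
    m ∈ A.I → K ⊆ A.I → L ⊆ A.I → (∀ k ∈ K, ∀ l ∈ L, k ≠ l) → m ∉ K → m ∉ L →
    nL ≤ L.card → nK ≤ K.card →
    ∀ (s : ℕ → ℕ) (X : ℕ → ℕ → Finset ℕ) (Y : ℕ → Finset ℕ),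
    (∀ l ∈ L, s l ∈ A.P l m) → (∀ k ∈ K, ∀ l ∈ L, X k l ⊆ A.P k l) →
    (∀ k ∈ K, Y k ⊆ A.P k m) →
    (∀ l ∈ L, ∃ K' ⊆ K, μ1 * (K.card : ℝ) ≤ (K'.card : ℝ) ∧ ∀ k ∈ K',
      μ1 * (((A.P k l).card : ℝ) * ((A.P k m).card : ℝ)) ≤
        (((X k l ×ˢ Y k).filter (fun p => A.Edge p.1 p.2 (s l))).card : ℝ)) →
    ∀ (bK bL : ℕ → ℕ → ℕ → ℕ → Prop),
    (∀ k ∈ K, ∀ k' ∈ K, k ≠ k' → ∀ l ∈ L,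
      (((X k l ×ˢ X k' l).filter (fun p => bK k k' p.1 p.2)).card : ℝ) ≤
        ν * (((A.P k l).card : ℝ) * ((A.P k' l).card : ℝ))) →
    (∀ k ∈ K, ∀ k' ∈ K, k ≠ k' →
      (((Y k ×ˢ Y k').filter (fun p => bK k k' p.1 p.2)).card : ℝ) ≤
        ν * (((A.P k m).card : ℝ) * ((A.P k' m).card : ℝ))) →
    (∀ l ∈ L, ∀ l' ∈ L, l ≠ l' → ∀ k ∈ K,
      (((X k l ×ˢ X k l').filter (fun p => bL l l' p.1 p.2)).card : ℝ) ≤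
        ν * (((A.P k l).card : ℝ) * ((A.P k l').card : ℝ))) →
    (∀ k ∈ K, ∀ k' ∈ K, k ≠ k' → ∀ l ∈ L, ∀ x ∈ X k l, ∀ x' ∈ X k' l, ∀ y ∈ Y k, ∀ y' ∈ Y k',
      ¬ bK k k' x x' → ¬ bK k k' y y' →
      ε * ((A.P k k').card : ℝ) ≤ ((A.nbhd k k' x x' ∩ A.nbhd k k' y y').card : ℝ)) →
    (∀ l ∈ L, ∀ l' ∈ L, l ≠ l' → ∀ k ∈ K, ∀ x ∈ X k l, ∀ x' ∈ X k l', ¬ bL l l' x x' →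
      ε * ((A.P l l').card : ℝ) ≤ ((A.nbhd l l' x x' ∩ A.nbhd l l' (s l) (s l')).card : ℝ)) →
    A.SupportsK5 := by
  obtain ⟨T, hT0, hT⟩ := core2 ε hε
  obtain ⟨nL, hnL⟩ := exNat (μ1 / 4 * (μ1 / 2)) T (by positivity)
  obtain ⟨s2, hs2⟩ := hT nL
  obtain ⟨nK, hnK⟩ := exNat (μ1 / 2) (2 ^ nL * (2 ^ nL * (s2 + 1) : ℕ)) (by positivity)
  set n1 : ℕ := 2 ^ nL * (s2 + 1) with hn1
  obtain ⟨νA, hνA, hpA⟩ := pick (ι := ℕ) n1 (μ1 / 4) (by positivity)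
  obtain ⟨νB, hνB, hpB⟩ := pick (ι := ℕ × ℕ) (n1 * nL) (μ1 / 2) (by positivity)
  refine ⟨nL, nK, min νA νB, lt_min hνA hνB, ?_⟩
  intro A m K L0 hm hK hL0 hKL0 hmK hmL0 hL0n hKn s X Y hs0 hX0 hY hden0 bK bL hb10 hb2 hb30 hg10 hg20
  obtain ⟨L, hLL0, hLc⟩ := Finset.exists_subset_card_eq hL0n
  have hTr : (0 : ℝ) < T := by exact_mod_cast hT0
  have hnLpos : 0 < nL := by
    rcases Nat.eq_zero_or_pos nL with h | h
    · rw [h] at hnL; simp at hnL; linarith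
    · exact h
  have hn1pos : 0 < n1 := by positivity
  have hnKpos : 0 < nK := by
    rcases Nat.eq_zero_or_pos nK with h | h
    · rw [h] at hnK
      have : (0 : ℝ) < 2 ^ nL * (n1 : ℝ) := by positivity
      simp at hnK; linarith
    · exact h
  have hLne : L.Nonempty := Finset.card_pos.1 (by omega)
  have hKne : K.Nonempty := Finset.card_pos.1 (by omega)
  obtain ⟨K1', hK1', L1, hL1, hK1c', hL1c, hden⟩ := biq K L
    (fun k l => μ1 * (((A.P k l).card : ℝ) * ((A.P k m).card : ℝ)) ≤
        (((X k l ×ˢ Y k).filter (fun p => A.Edge p.1 p.2 (s l))).card : ℝ)) μ1 hμ1 hKne hLne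
    (fun l hl => hden0 l (hLL0 hl))
  rw [hLc] at hK1c' hL1c
  have hK1n : n1 ≤ K1'.card := by
    have h1 : (nK : ℝ) ≤ K.card := by exact_mod_cast hKn
    have h2 : (2 : ℝ) ^ nL * n1 ≤ 2 ^ nL * K1'.card := by
      refine hnK.trans (le_trans ?_ hK1c'); gcongr
    have h3 := le_of_mul_le_mul_left h2 (by positivity)
    exact_mod_cast h3
  obtain ⟨K1, hK1K1', hK1c⟩ := Finset.exists_subset_card_eq hK1n
  have hK1 : K1 ⊆ K := hK1K1'.trans hK1'
  have hL1L0 : L1 ⊆ L0 := hL1.trans hLL0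
  have hL1n : L1.card ≤ nL := hLc ▸ Finset.card_le_card hL1
  have hL1pos : 0 < L1.card := by
    have h0 : (0 : ℝ) < nL := by exact_mod_cast hnLpos
    have : (0 : ℝ) < L1.card := lt_of_lt_of_le (by positivity) hL1c
    exact_mod_cast this
  have hL1ne := Finset.card_pos.1 hL1pos
  have hne : ∀ k ∈ K, ∀ l ∈ L0, k ≠ l := hKL0
  have hkm : ∀ k ∈ K, k ≠ m := fun k hk h => hmK (h ▸ hk)
  have stepY : ∀ k, k ∈ K1 → ∃ G ⊆ Y k, μ1 / 4 * ((A.P k m).card : ℝ) ≤ (G.card : ℝ) ∧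
      ∀ y ∈ G, μ1 / 4 * (L1.card : ℝ) ≤ ((L1.filter (fun l => μ1 / 2 * ((A.P k l).card : ℝ) ≤
        (((X k l).filter (fun x => A.Edge x y (s l))).card : ℝ))).card : ℝ) := by
    intro k hk
    have hkK := hK1 hk
    have := avgS L1 (Y k) (fun l y => μ1 / 2 * ((A.P k l).card : ℝ) ≤
        (((X k l).filter (fun x => A.Edge x y (s l))).card : ℝ)) ((A.P k m).card) (μ1 / 2) hL1ne
      (by positivity) (by exact_mod_cast Finset.card_le_card (hY k hkK)) (by
        intro l hl
        exact avgE (X k l) (Y k) (fun x y => A.Edge x y (s l)) (A.P k l).card (A.P k m).card μ1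
          (Ppos A (hK hkK) (hL0 (hL1L0 hl)) (hne k hkK l (hL1L0 hl))) hμ1.le
          (by exact_mod_cast Finset.card_le_card (hX0 k hkK l (hL1L0 hl)))
          (by exact_mod_cast Finset.card_le_card (hY k hkK))
          (hden k (hK1K1' hk) l hl))
    obtain ⟨G, h1, h2, h3⟩ := this
    refine ⟨G, h1, by linarith, fun y hy => ?_⟩
    have h4 := h3 y hy
    rw [show μ1 / 2 / 2 = μ1 / 4 by ring] at h4
    convert h4
  choose! Y' hY'1 hY'2 hY'3 using stepY
  obtain ⟨r, hr1, hr2⟩ := hpA K1 hK1c.le (fun k => A.P k m) Y'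
    (fun k hk => A.Pnonempty _ _ (hK (hK1 hk)) hm (hkm k (hK1 hk)))
    (fun k hk => (hY'1 k hk).trans (hY k (hK1 hk))) hY'2 bK (by
      intro k hk k' hk' hkk'
      refine le_trans ?_ ((hb2 k (hK1 hk) k' (hK1 hk') hkk').trans ?_)
      · exact_mod_cast Finset.card_le_card (Finset.filter_subset_filter _
          (Finset.product_subset_product (hY'1 k hk) (hY'1 k' hk')))
      · gcongr; exact min_le_left _ _)
  have hrY : ∀ k ∈ K1, r k ∈ Y k := fun k hk => hY'1 k hk (hr1 k hk)
  obtain ⟨K2, hK2, L2, hL2, hK2c, hL2c, hE⟩ := biq' K1 L1 (fun k l => μ1 / 2 * ((A.P k l).card : ℝ) ≤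
        (((X k l).filter (fun x => A.Edge x (r k) (s l))).card : ℝ)) (μ1 / 4 * (L1.card : ℝ))
    (Finset.card_pos.1 (by omega)) (by
      intro k hk
      convert hY'3 k hk (r k) (hr1 k hk))
  have hL2L0 : L2 ⊆ L0 := hL2.trans hL1L0
  have hK2K : K2 ⊆ K := hK2.trans hK1
  have hL2n : L2.card ≤ nL := (Finset.card_le_card hL2).trans hL1n
  have hTL2 : T ≤ L2.card := by
    have h1 : (T : ℝ) ≤ L2.card := by
      refine hnL.trans (le_trans ?_ hL2c)
      rw [mul_assoc]
      gcongr
    exact_mod_cast h1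
  have hsK2 : s2 ≤ K2.card := by
    rw [hK1c] at hK2c
    have h1 : (2 : ℝ) ^ L1.card ≤ 2 ^ nL := pow_le_pow_right₀ (by norm_num) hL1n
    have h2 : (n1 : ℝ) ≤ 2 ^ nL * K2.card := hK2c.trans (by gcongr)
    rw [hn1] at h2
    push_cast at h2
    have h3 := le_of_mul_le_mul_left h2 (by positivity)
    have h4 : (s2 : ℝ) ≤ K2.card := by linarith
    exact_mod_cast h4
  obtain ⟨q, hq1, hq2⟩ := hpB (K2 ×ˢ L2)
    (by rw [Finset.card_product]
        exact Nat.mul_le_mul ((Finset.card_le_card hK2).trans hK1c.le) hL2n)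
    (fun p => A.P p.1 p.2) (fun p => (X p.1 p.2).filter (fun x => A.Edge x (r p.1) (s p.2)))
    (fun p hp => by
      obtain ⟨h1, h2⟩ := Finset.mem_product.1 hp
      exact A.Pnonempty _ _ (hK (hK2K h1)) (hL0 (hL2L0 h2)) (hne _ (hK2K h1) _ (hL2L0 h2)))
    (fun p hp => by
      obtain ⟨h1, h2⟩ := Finset.mem_product.1 hp
      exact (Finset.filter_subset _ _).trans (hX0 _ (hK2K h1) _ (hL2L0 h2)))
    (fun p hp => by
      obtain ⟨h1, h2⟩ := Finset.mem_product.1 hp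
      exact hE _ h1 _ h2)
    (fun p p' x x' => (p.2 = p'.2 ∧ bK p.1 p'.1 x x') ∨ (p.1 = p'.1 ∧ bL p.2 p'.2 x x'))
    (by
      rintro ⟨k, l⟩ hp ⟨k', l'⟩ hp' hne'
      obtain ⟨hk, hl⟩ := Finset.mem_product.1 hp
      obtain ⟨hk', hl'⟩ := Finset.mem_product.1 hp'
      simp only at hk hl hk' hl' ⊢
      have key : ∀ b : ℕ → ℕ → Prop, (∀ x x', ((l = l' ∧ bK k k' x x') ∨ (k = k' ∧ bL l l' x x')) → b x x') →
          ((((X k l ×ˢ X k' l').filter (fun p => b p.1 p.2)).card : ℝ) ≤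
            νB * (((A.P k l).card : ℝ) * ((A.P k' l').card : ℝ))) →
          ((((X k l).filter (fun x => A.Edge x (r k) (s l)) ×ˢ
            (X k' l').filter (fun x => A.Edge x (r k') (s l'))).filter
            (fun p => (l = l' ∧ bK k k' p.1 p.2) ∨ (k = k' ∧ bL l l' p.1 p.2))).card : ℝ) ≤
            νB * (((A.P k l).card : ℝ) * ((A.P k' l').card : ℝ)) := by
        intro b hb hb'
        refine le_trans ?_ hb'
        norm_cast
        apply Finset.card_le_card
        intro p hp
        rw [Finset.mem_filter, Finset.mem_product, Finset.mem_filter, Finset.mem_filter] at hp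
        rw [Finset.mem_filter, Finset.mem_product]
        exact ⟨⟨hp.1.1.1, hp.1.2.1⟩, hb _ _ hp.2⟩
      have hmin : ∀ u : ℝ, 0 ≤ u → min νA νB * u ≤ νB * u := fun u hu =>
        mul_le_mul_of_nonneg_right (min_le_right _ _) hu
      have hgoal : ((((X k l).filter (fun x => A.Edge x (r k) (s l)) ×ˢ
            (X k' l').filter (fun x => A.Edge x (r k') (s l'))).filter
            (fun p => (l = l' ∧ bK k k' p.1 p.2) ∨ (k = k' ∧ bL l l' p.1 p.2))).card : ℝ) ≤
            νB * (((A.P k l).card : ℝ) * ((A.P k' l').card : ℝ)) := by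
        by_cases hll : l = l'
        · subst hll
          have hkk : k ≠ k' := fun h => hne' (by rw [h])
          refine key (bK k k') (fun x x' h => by tauto) ?_
          exact (hb10 k (hK2K hk) k' (hK2K hk') hkk l (hL2L0 hl)).trans (hmin _ (by positivity))
        · by_cases hkk : k = k'
          · subst hkk
            refine key (bL l l') (fun x x' h => by tauto) ?_
            exact (hb30 l (hL2L0 hl) l' (hL2L0 hl') hll k (hK2K hk)).trans (hmin _ (by positivity))
          · refine key (fun _ _ => False) (fun x x' h => by tauto) ?_
            simp only [Finset.filter_false, Finset.card_empty, Nat.cast_zero]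
            positivity
      convert hgoal)
  have hq1' : ∀ k ∈ K2, ∀ l ∈ L2, q (k, l) ∈ X k l ∧ A.Edge (q (k, l)) (r k) (s l) := by
    intro k hk l hl
    have := hq1 (k, l) (Finset.mem_product.2 ⟨hk, hl⟩)
    exact Finset.mem_filter.1 this
  refine hs2 A m K2 L2 hm (hK2K.trans hK) (hL2L0.trans hL0)
    (fun k hk l hl => hne k (hK2K hk) l (hL2L0 hl)) (fun h => hmK (hK2K h))
    (fun h => hmL0 (hL2L0 h)) hTL2 hL2n hsK2 s r (fun k l => q (k, l))
    (fun l hl => hs0 l (hL2L0 hl)) (fun k hk => hY k (hK2K hk) (hrY k (hK2 hk)))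
    (fun k hk l hl => hX0 k (hK2K hk) l (hL2L0 hl) (hq1' k hk l hl).1)
    (fun k hk l hl => (hq1' k hk l hl).2) ?_ ?_
  · intro k hk k' hk' hkk l hl
    refine hg10 k (hK2K hk) k' (hK2K hk') hkk l (hL2L0 hl) _ (hq1' k hk l hl).1 _
      (hq1' k' hk' l hl).1 _ (hrY k (hK2 hk)) _ (hrY k' (hK2 hk')) ?_
      (hr2 k (hK2 hk) k' (hK2 hk') hkk)
    intro hb
    exact hq2 (k, l) (Finset.mem_product.2 ⟨hk, hl⟩) (k', l) (Finset.mem_product.2 ⟨hk', hl⟩)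
      (fun h => hkk (Prod.mk.inj h).1) (Or.inl ⟨rfl, hb⟩)
  · intro l hl l' hl' hll k hk
    refine hg20 l (hL2L0 hl) l' (hL2L0 hl') hll k (hK2K hk) _ (hq1' k hk l hl).1 _
      (hq1' k hk l' hl').1 ?_
    intro hb
    exact hq2 (k, l) (Finset.mem_product.2 ⟨hk, hl⟩) (k, l') (Finset.mem_product.2 ⟨hk, hl'⟩)
      (fun h => hll (Prod.mk.inj h).2) (Or.inr ⟨rfl, hb⟩)

end AU

namespace AU

lemma lemS (μ0 : ℝ) (hμ0 : 0 < μ0) (nL nM : ℕ) : ∃ ν : ℝ, 0 < ν ∧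
    ∀ (A : ReducedHG) (K L M : Finset ℕ), K ⊆ A.I → L ⊆ A.I → M ⊆ A.I →
    (∀ k ∈ K, ∀ l ∈ L, k ≠ l) → (∀ k ∈ K, ∀ m ∈ M, k ≠ m) → (∀ l ∈ L, ∀ m ∈ M, l ≠ m) →
    K.Nonempty → L.card ≤ nL → M.card ≤ nM →
    ∀ (X Y Z : ℕ → ℕ → Finset ℕ), (∀ k ∈ K, ∀ l ∈ L, X k l ⊆ A.P k l) →
    (∀ k ∈ K, ∀ m ∈ M, Y k m ⊆ A.P k m) → (∀ l ∈ L, ∀ m ∈ M, Z l m ⊆ A.P l m) →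
    (∀ k ∈ K, ∀ l ∈ L, ∀ m ∈ M,
      μ0 * (((A.P k l).card : ℝ) * ((A.P k m).card : ℝ) * ((A.P l m).card : ℝ)) ≤
        (A.ecount (X k l) (Y k m) (Z l m) : ℝ)) →
    ∀ bL : ℕ → ℕ → ℕ → ℕ → Prop,
    (∀ l ∈ L, ∀ l' ∈ L, l ≠ l' → ∀ m ∈ M,
      (((Z l m ×ˢ Z l' m).filter (fun p => bL l l' p.1 p.2)).card : ℝ) ≤
        ν * (((A.P l m).card : ℝ) * ((A.P l' m).card : ℝ))) →
    ∃ s : ℕ → ℕ → ℕ, (∀ l ∈ L, ∀ m ∈ M, s l m ∈ Z l m) ∧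
      (∀ l ∈ L, ∀ l' ∈ L, l ≠ l' → ∀ m ∈ M, ¬ bL l l' (s l m) (s l' m)) ∧
      ∀ m ∈ M, ∀ l ∈ L, ∃ K' ⊆ K, μ0 / 4 * (K.card : ℝ) ≤ (K'.card : ℝ) ∧ ∀ k ∈ K',
        μ0 / 4 * (((A.P k l).card : ℝ) * ((A.P k m).card : ℝ)) ≤
          (((X k l ×ˢ Y k m).filter (fun p => A.Edge p.1 p.2 (s l m))).card : ℝ) := by
  obtain ⟨ν, hν, hp⟩ := pick (ι := ℕ × ℕ) (nL * nM) (μ0 / 4) (by positivity)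
  refine ⟨ν, hν, ?_⟩
  intro A K L M hK hL hM hKL hKM hLM hKne hLn hMn X Y Z hX hY hZ hec bL hbL
  have step : ∀ l m, l ∈ L → m ∈ M → ∃ G ⊆ Z l m, μ0 / 4 * ((A.P l m).card : ℝ) ≤ (G.card : ℝ) ∧
      ∀ z ∈ G, ∃ K' ⊆ K, μ0 / 4 * (K.card : ℝ) ≤ (K'.card : ℝ) ∧ ∀ k ∈ K',
        μ0 / 4 * (((A.P k l).card : ℝ) * ((A.P k m).card : ℝ)) ≤
          (((X k l ×ˢ Y k m).filter (fun p => A.Edge p.1 p.2 z)).card : ℝ) := by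
    intro l m hl hm
    obtain ⟨G, h1, h2, h3⟩ := avgS K (Z l m)
      (fun k z => μ0 / 2 * (((A.P k l).card : ℝ) * ((A.P k m).card : ℝ)) ≤
          (((X k l ×ˢ Y k m).filter (fun p => A.Edge p.1 p.2 z)).card : ℝ))
      ((A.P l m).card) (μ0 / 2) hKne (by positivity)
      (by exact_mod_cast Finset.card_le_card (hZ l hl m hm)) (by
        intro k hk
        have hc : ((X k l ×ˢ Y k m).card : ℝ) ≤ ((A.P k l).card : ℝ) * ((A.P k m).card : ℝ) := by
          rw [Finset.card_product]
          exact_mod_cast Nat.mul_le_mul (Finset.card_le_card (hX k hk l hl))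
            (Finset.card_le_card (hY k hk m hm))
        refine avgE (X k l ×ˢ Y k m) (Z l m) (fun p z => A.Edge p.1 p.2 z) _ _ μ0
          (mul_pos (Ppos A (hK hk) (hL hl) (hKL k hk l hl)) (Ppos A (hK hk) (hM hm) (hKM k hk m hm)))
          hμ0.le hc (by exact_mod_cast Finset.card_le_card (hZ l hl m hm)) ?_
        rw [← ecount_assoc]
        exact hec k hk l hl m hm)
    refine ⟨G, h1, by linarith, fun z hz => ?_⟩
    refine ⟨_, Finset.filter_subset _ _, le_trans (le_of_eq (by ring)) (h3 z hz), fun k hk => ?_⟩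
    refine le_trans ?_ (Finset.mem_filter.1 hk).2
    have : 0 ≤ μ0 * (((A.P k l).card : ℝ) * ((A.P k m).card : ℝ)) := by positivity
    linarith
  choose! G hG1 hG2 hG3 using step
  obtain ⟨s, hs1, hs2⟩ := hp (L ×ˢ M)
    (by rw [Finset.card_product]; exact Nat.mul_le_mul hLn hMn)
    (fun p => A.P p.1 p.2) (fun p => G p.1 p.2)
    (fun p hp => by
      obtain ⟨h1, h2⟩ := Finset.mem_product.1 hp
      exact A.Pnonempty _ _ (hL h1) (hM h2) (hLM _ h1 _ h2))
    (fun p hp => by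
      obtain ⟨h1, h2⟩ := Finset.mem_product.1 hp
      exact (hG1 _ _ h1 h2).trans (hZ _ h1 _ h2))
    (fun p hp => by
      obtain ⟨h1, h2⟩ := Finset.mem_product.1 hp
      exact hG2 _ _ h1 h2)
    (fun p p' x x' => p.2 = p'.2 ∧ bL p.1 p'.1 x x')
    (by
      rintro ⟨l, m⟩ hp ⟨l', m'⟩ hp' hne
      obtain ⟨hl, hm⟩ := Finset.mem_product.1 hp
      obtain ⟨hl', hm'⟩ := Finset.mem_product.1 hp'
      simp only at hl hm hl' hm' ⊢
      by_cases hmm : m = m'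
      · subst hmm
        have hll : l ≠ l' := fun h => hne (by rw [h])
        refine le_trans ?_ (hbL l hl l' hl' hll m hm)
        norm_cast
        apply Finset.card_le_card
        intro p hp
        rw [Finset.mem_filter, Finset.mem_product] at hp ⊢
        exact ⟨⟨hG1 _ _ hl hm hp.1.1, hG1 _ _ hl' hm hp.1.2⟩, hp.2.2⟩
      · have : ∀ p : ℕ × ℕ, ¬ (m = m' ∧ bL l l' p.1 p.2) := fun p h => hmm h.1
        rw [Finset.filter_false_of_mem (fun p _ => this p)]
        simp only [Finset.card_empty, Nat.cast_zero]
        positivity)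
  refine ⟨fun l m => s (l, m), ?_, ?_, ?_⟩
  · intro l hl m hm
    exact hG1 l m hl hm (hs1 (l, m) (Finset.mem_product.2 ⟨hl, hm⟩))
  · intro l hl l' hl' hll m hm hb
    exact hs2 (l, m) (Finset.mem_product.2 ⟨hl, hm⟩) (l', m) (Finset.mem_product.2 ⟨hl', hm⟩)
      (fun h => hll (Prod.mk.inj h).1) ⟨rfl, hb⟩
  · intro m hm l hl
    exact hG3 l m hl hm _ (hs1 (l, m) (Finset.mem_product.2 ⟨hl, hm⟩))

lemma lemG (ε μ0 : ℝ) (hε : 0 < ε) (hμ0 : 0 < μ0) : ∃ nL nK : ℕ, ∃ ν : ℝ, 0 < ν ∧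
    ∀ (A : ReducedHG) (m : ℕ) (K L : Finset ℕ),
    m ∈ A.I → K ⊆ A.I → L ⊆ A.I → (∀ k ∈ K, ∀ l ∈ L, k ≠ l) → m ∉ K → m ∉ L →
    nL ≤ L.card → nK ≤ K.card →
    ∀ (X : ℕ → ℕ → Finset ℕ) (Y Z : ℕ → Finset ℕ),
    (∀ k ∈ K, ∀ l ∈ L, X k l ⊆ A.P k l) →
    (∀ k ∈ K, Y k ⊆ A.P k m) → (∀ l ∈ L, Z l ⊆ A.P l m) →
    (∀ k ∈ K, ∀ l ∈ L,
      μ0 * (((A.P k l).card : ℝ) * ((A.P k m).card : ℝ) * ((A.P l m).card : ℝ)) ≤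
        (A.ecount (X k l) (Y k) (Z l) : ℝ)) →
    ∀ (bK bL : ℕ → ℕ → ℕ → ℕ → Prop),
    (∀ k ∈ K, ∀ k' ∈ K, k ≠ k' → ∀ l ∈ L,
      (((X k l ×ˢ X k' l).filter (fun p => bK k k' p.1 p.2)).card : ℝ) ≤
        ν * (((A.P k l).card : ℝ) * ((A.P k' l).card : ℝ))) →
    (∀ k ∈ K, ∀ k' ∈ K, k ≠ k' →
      (((Y k ×ˢ Y k').filter (fun p => bK k k' p.1 p.2)).card : ℝ) ≤
        ν * (((A.P k m).card : ℝ) * ((A.P k' m).card : ℝ))) →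
    (∀ l ∈ L, ∀ l' ∈ L, l ≠ l' → ∀ k ∈ K,
      (((X k l ×ˢ X k l').filter (fun p => bL l l' p.1 p.2)).card : ℝ) ≤
        ν * (((A.P k l).card : ℝ) * ((A.P k l').card : ℝ))) →
    (∀ l ∈ L, ∀ l' ∈ L, l ≠ l' →
      (((Z l ×ˢ Z l').filter (fun p => bL l l' p.1 p.2)).card : ℝ) ≤
        ν * (((A.P l m).card : ℝ) * ((A.P l' m).card : ℝ))) →
    (∀ k ∈ K, ∀ k' ∈ K, k ≠ k' → ∀ l ∈ L, ∀ x ∈ X k l, ∀ x' ∈ X k' l, ∀ y ∈ Y k, ∀ y' ∈ Y k',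
      ¬ bK k k' x x' → ¬ bK k k' y y' →
      ε * ((A.P k k').card : ℝ) ≤ ((A.nbhd k k' x x' ∩ A.nbhd k k' y y').card : ℝ)) →
    (∀ l ∈ L, ∀ l' ∈ L, l ≠ l' → ∀ k ∈ K, ∀ x ∈ X k l, ∀ x' ∈ X k l', ∀ z ∈ Z l, ∀ z' ∈ Z l',
      ¬ bL l l' x x' → ¬ bL l l' z z' →
      ε * ((A.P l l').card : ℝ) ≤ ((A.nbhd l l' x x' ∩ A.nbhd l l' z z').card : ℝ)) →
    A.SupportsK5 := by
  obtain ⟨nL, nK, ν1, hν1, hc⟩ := core ε (μ0 / 4) hε (by positivity)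
  obtain ⟨ν2, hν2, hS⟩ := lemS μ0 hμ0 nL 1
  refine ⟨nL, nK + 1, min ν1 ν2, lt_min hν1 hν2, ?_⟩
  intro A m K L0 hm hK hL0 hKL hmK hmL hLn hKn X Y Z hX hY hZ hec bK bL h1 h2 h3 h4 h5 h6
  obtain ⟨L, hLL0, hLc⟩ := Finset.exists_subset_card_eq hLn
  have hmin1 : ∀ u : ℝ, 0 ≤ u → min ν1 ν2 * u ≤ ν1 * u := fun u hu =>
    mul_le_mul_of_nonneg_right (min_le_left _ _) hu
  have hmin2 : ∀ u : ℝ, 0 ≤ u → min ν1 ν2 * u ≤ ν2 * u := fun u hu =>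
    mul_le_mul_of_nonneg_right (min_le_right _ _) hu
  obtain ⟨s, hs1, hs2, hs3⟩ := hS A K L {m} hK (hLL0.trans hL0) (by simpa using hm)
    (fun k hk l hl => hKL k hk l (hLL0 hl))
    (fun k hk m' hm' h => by rw [Finset.mem_singleton] at hm'; subst hm'; exact hmK (h ▸ hk))
    (fun k hk m' hm' h => by
      rw [Finset.mem_singleton] at hm'; subst hm'; exact hmL (hLL0 (h ▸ hk)))
    (Finset.card_pos.1 (by omega)) hLc.le (by simp) X (fun k _ => Y k) (fun l _ => Z l)
    (fun k hk l hl => hX k hk l (hLL0 hl))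
    (fun k hk m' hm' => by rw [Finset.mem_singleton] at hm'; subst hm'; exact hY k hk)
    (fun l hl m' hm' => by rw [Finset.mem_singleton] at hm'; subst hm'; exact hZ l (hLL0 hl))
    (fun k hk l hl m' hm' => by
      rw [Finset.mem_singleton] at hm'; subst hm'; exact hec k hk l (hLL0 hl))
    bL (fun l hl l' hl' hll m' hm' => by
      rw [Finset.mem_singleton] at hm'; subst hm'
      exact (h4 l (hLL0 hl) l' (hLL0 hl') hll).trans (hmin2 _ (by positivity)))
  have hmm : m ∈ ({m} : Finset ℕ) := Finset.mem_singleton_self m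
  exact hc A m K L hm hK (hLL0.trans hL0) (fun k hk l hl => hKL k hk l (hLL0 hl)) hmK
    (fun h => hmL (hLL0 h)) hLc.ge (by omega) (fun l => s l m) X Y
    (fun l hl => hZ l (hLL0 hl) (hs1 l hl m hmm)) (fun k hk l hl => hX k hk l (hLL0 hl)) hY
    (hs3 m hmm) bK bL
    (fun k hk k' hk' hkk l hl => (h1 k hk k' hk' hkk l (hLL0 hl)).trans (hmin1 _ (by positivity)))
    (fun k hk k' hk' hkk => (h2 k hk k' hk' hkk).trans (hmin1 _ (by positivity)))
    (fun l hl l' hl' hll k hk =>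
      (h3 l (hLL0 hl) l' (hLL0 hl') hll k hk).trans (hmin1 _ (by positivity)))
    (fun k hk k' hk' hkk l hl => h5 k hk k' hk' hkk l (hLL0 hl))
    (fun l hl l' hl' hll k hk x hx x' hx' hb =>
      h6 l (hLL0 hl) l' (hLL0 hl') hll k hk x hx x' hx' _ (hs1 l hl m hmm) _ (hs1 l' hl' m hmm)
        hb (hs2 l hl l' hl' hll m hmm))

end AU

namespace AU

lemma two_meet (P H Ψ N : Finset ℕ) (ε : ℝ) (hN : N ⊆ P)
    (h1 : (1/3 + ε) * (P.card : ℝ) ≤ N.card) (h2 : (1/3 + ε) * (P.card : ℝ) ≤ (H ∩ P).card)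
    (h3 : (1/3 + ε) * (P.card : ℝ) ≤ (Ψ ∩ P).card)
    (h4 : ((H ∩ Ψ ∩ P).card : ℝ) < ε * (P.card : ℝ)) :
    2 * ε * (P.card : ℝ) ≤ ((N ∩ H).card : ℝ) + ((N ∩ Ψ).card : ℝ) := by
  have := three P N (H ∩ P) (Ψ ∩ P) ε hN Finset.inter_subset_right Finset.inter_subset_right h1 h2 h3
  have e1 : N ∩ (H ∩ P) = N ∩ H := by
    ext x; simp only [Finset.mem_inter]; constructor
    · tauto
    · intro h; exact ⟨h.1, h.2, hN h.1⟩
  have e2 : N ∩ (Ψ ∩ P) = N ∩ Ψ := by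
    ext x; simp only [Finset.mem_inter]; constructor
    · tauto
    · intro h; exact ⟨h.1, h.2, hN h.1⟩
  have e3 : (H ∩ P) ∩ (Ψ ∩ P) = H ∩ Ψ ∩ P := by
    ext x; simp only [Finset.mem_inter]; tauto
  rw [e1, e2, e3] at this
  linarith

lemma filt_mono {X X' Y Y' : Finset ℕ} (b : ℕ → ℕ → Prop) (hX : X ⊆ X') (hY : Y ⊆ Y') :
    (((X ×ˢ Y).filter (fun p => b p.1 p.2)).card : ℝ) ≤
      (((X' ×ˢ Y').filter (fun p => b p.1 p.2)).card : ℝ) := by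
  exact_mod_cast Finset.card_le_card (Finset.filter_subset_filter _
    (Finset.product_subset_product hX hY))

lemma lemF0 (ε μ0 : ℝ) (hε : 0 < ε) (hμ0 : 0 < μ0) : ∃ nL nK : ℕ, ∃ ν : ℝ, 0 < ν ∧
    ∀ (A : ReducedHG) (J : Finset ℕ), A.EEDense (1/3 + ε) → J ⊆ A.I →
    ∀ H H2 : Finset ℕ, A.IsHoleW ν (1/3 + ε) J H →
    ∀ D : ℕ → ℕ → Finset ℕ,
    (∀ i ∈ J, ∀ j ∈ J, i ≠ j → D i j ⊆ A.P i j) →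
    ∀ b : ℕ → ℕ → ℕ → ℕ → Prop,
    (∀ k ∈ J, ∀ k' ∈ J, ∀ l ∈ J, k ≠ k' → k ≠ l → k' ≠ l →
      (((D k l ×ˢ D k' l).filter (fun p => b k k' p.1 p.2)).card : ℝ) ≤
        ν * (((A.P k l).card : ℝ) * ((A.P k' l).card : ℝ))) →
    (∀ k ∈ J, ∀ k' ∈ J, ∀ l ∈ J, ∀ m ∈ J, k ≠ k' → k ≠ l → k' ≠ l → k ≠ m → k' ≠ m → l ≠ m →
      ∀ x ∈ D k l, ∀ x' ∈ D k' l, ∀ y ∈ D k m, ∀ y' ∈ D k' m, ¬ b k k' x x' → ¬ b k k' y y' →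
      ε * ((A.P k k').card : ℝ) ≤ ((A.nbhd k k' x x' ∩ A.nbhd k k' y y').card : ℝ)) →
    ∀ (m : ℕ) (K L : Finset ℕ),
    m ∈ J → K ⊆ J → L ⊆ J → (∀ k ∈ K, ∀ l ∈ L, k ≠ l) → m ∉ K → m ∉ L →
    nL ≤ L.card → nK ≤ K.card →
    (∀ k ∈ K, ∀ l ∈ L,
      μ0 * (((A.P k l).card : ℝ) * ((A.P k m).card : ℝ) * ((A.P l m).card : ℝ)) ≤
        (A.ecount (D k l ∩ H) (D k m ∩ H2) (H ∩ A.P l m) : ℝ)) → A.SupportsK5 := by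
  obtain ⟨nL, nK, ν, hν, hG⟩ := lemG ε μ0 hε hμ0
  refine ⟨nL, nK, min ν (ν * ε), lt_min hν (by positivity), ?_⟩
  intro A J hA hJ H H2 hH D hD b hb hint m K L hm hK hL hKL hmK hmL hLn hKn hec
  have hνε : min ν (ν * ε) / ε ≤ ν := by
    rw [div_le_iff₀ hε]; exact min_le_right _ _
  have hmin1 : ∀ u : ℝ, 0 ≤ u → min ν (ν * ε) * u ≤ ν * u := fun u hu =>
    mul_le_mul_of_nonneg_right (min_le_left _ _) hu
  have hmin2 : ∀ u : ℝ, 0 ≤ u → min ν (ν * ε) / ε * u ≤ ν * u := fun u hu =>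
    mul_le_mul_of_nonneg_right hνε hu
  have hkm : ∀ k ∈ K, k ≠ m := fun k hk h => hmK (h ▸ hk)
  have hlm : ∀ l ∈ L, l ≠ m := fun k hk h => hmL (h ▸ hk)
  have hDK : ∀ k ∈ K, ∀ l ∈ L, D k l ⊆ A.P k l := fun k hk l hl =>
    hD k (hK hk) l (hL hl) (hKL k hk l hl)
  have hXH : ∀ k ∈ K, ∀ l ∈ L, D k l ∩ H ⊆ H ∩ A.P l k := by
    intro k hk l hl x hx
    rw [Finset.mem_inter] at hx ⊢
    refine ⟨hx.2, ?_⟩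
    rw [A.Psymm]; exact hDK k hk l hl hx.1
  refine hG A m K L (hJ hm) (hK.trans hJ) (hL.trans hJ) hKL hmK hmL hLn hKn
    (fun k l => D k l ∩ H) (fun k => D k m ∩ H2) (fun l => H ∩ A.P l m)
    (fun k hk l hl => Finset.inter_subset_left.trans (hDK k hk l hl))
    (fun k hk => Finset.inter_subset_left.trans (hD k (hK hk) m hm (hkm k hk)))
    (fun l hl => Finset.inter_subset_right) hec b (bad A ε H) ?_ ?_ ?_ ?_ ?_ ?_
  · intro k hk k' hk' hkk l hl
    exact (filt_mono _ Finset.inter_subset_left Finset.inter_subset_left).trans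
      ((hb k (hK hk) k' (hK hk') l (hL hl) hkk (hKL k hk l hl) (hKL k' hk' l hl)).trans
        (hmin1 _ (by positivity)))
  · intro k hk k' hk' hkk
    exact (filt_mono _ Finset.inter_subset_left Finset.inter_subset_left).trans
      ((hb k (hK hk) k' (hK hk') m hm hkk (hkm k hk) (hkm k' hk')).trans
        (hmin1 _ (by positivity)))
  · intro l hl l' hl' hll k hk
    have := hole_bad hε hJ hH.1 (hL hl) (hL hl') (hK hk) hll (hKL k hk l hl).symm
      (hKL k hk l' hl').symm (hXH k hk l hl) (hXH k hk l' hl')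
    rw [A.Psymm k l, A.Psymm k l']
    exact this.trans (hmin2 _ (by positivity))
  · intro l hl l' hl' hll
    have := hole_bad hε hJ hH.1 (hL hl) (hL hl') hm hll (hlm l hl)
      (hlm l' hl') (Finset.Subset.refl (H ∩ A.P l m)) (Finset.Subset.refl (H ∩ A.P l' m))
    exact this.trans (hmin2 _ (by positivity))
  · intro k hk k' hk' hkk l hl x hx x' hx' y hy y' hy' b1 b2
    exact hint k (hK hk) k' (hK hk') l (hL hl) m hm hkk (hKL k hk l hl) (hKL k' hk' l hl)
      (hkm k hk) (hkm k' hk') (hlm l hl) x (Finset.mem_inter.1 hx).1 x' (Finset.mem_inter.1 hx').1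
      y (Finset.mem_inter.1 hy).1 y' (Finset.mem_inter.1 hy').1 b1 b2
  · intro l hl l' hl' hll k hk x hx x' hx' z hz z' hz' b1 b2
    exact good_inter hA hJ hH (hL hl) (hL hl') (hK hk) hm hll (hKL k hk l hl).symm
      (hKL k hk l' hl').symm (hlm l hl) (hlm l' hl')
      (Finset.mem_inter.1 (hXH k hk l hl hx)).2 (Finset.mem_inter.1 (hXH k hk l' hl' hx')).2
      (Finset.mem_inter.1 hz).2 (Finset.mem_inter.1 hz').2 b1 b2

lemma lemF (ε c : ℝ) (hε : 0 < ε) (hc : 0 < c) : ∃ n : ℕ, ∃ ν : ℝ, 0 < ν ∧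
    ∀ (A : ReducedHG) (J : Finset ℕ), A.Wicked ε → J ⊆ A.I → n ≤ J.card →
    ∀ H Ψ : Finset ℕ, A.IsHoleW ν (1/3 + ε) J H → A.IsHoleW ν (1/3 + ε) J Ψ →
    A.HolesDisjoint ε J H Ψ →
    ∀ D : ℕ → ℕ → Finset ℕ,
    (∀ i ∈ J, ∀ j ∈ J, i ≠ j → D i j ⊆ A.P i j) →
    (∀ i ∈ J, ∀ j ∈ J, i < j → c * ((A.P i j).card : ℝ) ≤ ((D i j ∩ H).card : ℝ)) →
    (∀ i ∈ J, ∀ j ∈ J, i < j → c * ((A.P i j).card : ℝ) ≤ ((D i j ∩ Ψ).card : ℝ)) →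
    ∀ b : ℕ → ℕ → ℕ → ℕ → Prop,
    (∀ k ∈ J, ∀ k' ∈ J, ∀ l ∈ J, k ≠ k' → k ≠ l → k' ≠ l →
      (((D k l ×ˢ D k' l).filter (fun p => b k k' p.1 p.2)).card : ℝ) ≤
        ν * (((A.P k l).card : ℝ) * ((A.P k' l).card : ℝ))) →
    (∀ k ∈ J, ∀ k' ∈ J, ∀ l ∈ J, ∀ m ∈ J, k ≠ k' → k ≠ l → k' ≠ l → k ≠ m → k' ≠ m → l ≠ m →
      ∀ x ∈ D k l, ∀ x' ∈ D k' l, ∀ y ∈ D k m, ∀ y' ∈ D k' m, ¬ b k k' x x' → ¬ b k k' y y' →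
      ε * ((A.P k k').card : ℝ) ≤ ((A.nbhd k k' x x' ∩ A.nbhd k k' y y').card : ℝ)) →
    False := by
  obtain ⟨nL, nK, ν, hν, hF⟩ := lemF0 ε (c * c * ε) hε (by positivity)
  obtain ⟨n, hn⟩ := ramsey3 (κ := Prop) (nK + nL + 1)
  refine ⟨n, ν, hν, ?_⟩
  intro A J hA hJ hJn H Ψ hH hΨ hdis D hD hDH hDΨ b hb hint
  have hor : ∀ i ∈ J, ∀ j ∈ J, ∀ k ∈ J, i < j → j < k →
      ¬ (c * c * ε * (((A.P i j).card : ℝ) * ((A.P i k).card : ℝ) * ((A.P j k).card : ℝ)) ≤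
        (A.ecount (D i j ∩ H) (D i k ∩ Ψ) (H ∩ A.P j k) : ℝ)) →
      (c * c * ε * (((A.P i j).card : ℝ) * ((A.P i k).card : ℝ) * ((A.P j k).card : ℝ)) ≤
        (A.ecount (D i j ∩ H) (D i k ∩ Ψ) (Ψ ∩ A.P j k) : ℝ)) := by
    intro i hi j hj k hk hij hjk hnot
    have hik := hij.trans hjk
    have hsum : 2 * (c * c * ε * (((A.P i j).card : ℝ) * ((A.P i k).card : ℝ) * ((A.P j k).card : ℝ)))
        ≤ (A.ecount (D i j ∩ H) (D i k ∩ Ψ) (H ∩ A.P j k) : ℝ) +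
          (A.ecount (D i j ∩ H) (D i k ∩ Ψ) (Ψ ∩ A.P j k) : ℝ) := by
      have e1 : ((D i j ∩ H).card : ℝ) * (D i k ∩ Ψ).card * (2 * ε * ((A.P j k).card : ℝ)) ≤
          (A.ecount (D i j ∩ H) (D i k ∩ Ψ) (H ∩ A.P j k) : ℝ) +
          (A.ecount (D i j ∩ H) (D i k ∩ Ψ) (Ψ ∩ A.P j k) : ℝ) := by
        rw [ecount_eq, ecount_eq, ← Finset.sum_add_distrib]
        have := Finset.card_nsmul_le_sum ((D i j ∩ H) ×ˢ (D i k ∩ Ψ))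
          (fun p => (((H ∩ A.P j k).filter (fun z => A.Edge p.1 p.2 z)).card : ℝ) +
            (((Ψ ∩ A.P j k).filter (fun z => A.Edge p.1 p.2 z)).card : ℝ))
          (2 * ε * ((A.P j k).card : ℝ)) (by
            intro p hp
            obtain ⟨h1, h2⟩ := Finset.mem_product.1 hp
            have h1' := hD i hi j hj hij.ne (Finset.mem_inter.1 h1).1
            have h2' := hD i hi k hk hik.ne (Finset.mem_inter.1 h2).1
            have h3 := two_meet (A.P j k) H Ψ _ ε (nbhd_sub A j k p.1 p.2)
              (deg hA.1 (hJ hj) (hJ hk) (hJ hi) hjk.ne hij.ne' hik.ne'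
                (by rw [A.Psymm]; exact h1') (by rw [A.Psymm]; exact h2'))
              (hH.2 j hj k hk hjk.ne) (hΨ.2 j hj k hk hjk.ne) (hdis j hj k hk hjk.ne)
            have e : ∀ H : Finset ℕ, A.nbhd j k p.1 p.2 ∩ H =
                (H ∩ A.P j k).filter (fun z => A.Edge p.1 p.2 z) := by
              intro H; ext z; simp only [Finset.mem_inter, mem_nbhd, Finset.mem_filter]; tauto
            rw [e H, e Ψ] at h3
            exact h3)
        rw [nsmul_eq_mul, Finset.card_product] at this
        push_cast at this
        exact this
      refine le_trans ?_ e1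
      have f1 := hDH i hi j hj hij
      have f2 := hDΨ i hi k hk hik
      have f3 : (c * ((A.P i j).card : ℝ)) * (c * ((A.P i k).card : ℝ)) ≤
        ((D i j ∩ H).card : ℝ) * (D i k ∩ Ψ).card := by gcongr
      have f4 := mul_le_mul_of_nonneg_right f3 (show 0 ≤ 2 * ε * ((A.P j k).card : ℝ) by positivity)
      linarith
    push Not at hnot
    linarith
  obtain ⟨J', hJ', hJ'c, col, hcol⟩ := hn J hJn (fun i j k =>
    (c * c * ε * (((A.P i j).card : ℝ) * ((A.P i k).card : ℝ) * ((A.P j k).card : ℝ)) ≤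
        (A.ecount (D i j ∩ H) (D i k ∩ Ψ) (H ∩ A.P j k) : ℝ)))
  apply hA.2
  by_cases hcc : col
  · obtain ⟨K, hK, L, hL, M, hM, hKc, hLc, hMc, hKL, hKM, hLM⟩ := blocks nK nL 1 J' hJ'c
    obtain ⟨m, rfl⟩ := Finset.card_eq_one.1 hMc
    have hm : m ∈ J' := hM (Finset.mem_singleton_self m)
    have hm1 := Finset.mem_singleton_self m
    refine hF A J hA.1 hJ H Ψ hH D hD b hb hint m K L (hJ' hm) (hK.trans hJ') (hL.trans hJ')
      (fun k hk l hl => (hKL k hk l hl).ne) (fun h => lt_irrefl _ (hKM m h m hm1))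
      (fun h => lt_irrefl _ (hLM m h m hm1)) hLc.ge hKc.ge ?_
    intro k hk l hl
    have := hcol k (hK hk) l (hL hl) m hm (hKL k hk l hl) (hLM l hl m hm1)
    exact this.symm ▸ hcc
  · obtain ⟨K, hK, M, hM, L, hL, hKc, hMc, hLc, hKM, hKL, hML⟩ :=
      blocks nK 1 nL J' (by omega)
    obtain ⟨m, rfl⟩ := Finset.card_eq_one.1 hMc
    have hm : m ∈ J' := hM (Finset.mem_singleton_self m)
    have hm1 := Finset.mem_singleton_self m
    refine hF A J hA.1 hJ Ψ H hΨ D hD b hb hint m K L (hJ' hm) (hK.trans hJ') (hL.trans hJ')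
      (fun k hk l hl => (hKL k hk l hl).ne) (fun h => lt_irrefl _ (hKM m h m hm1))
      (fun h => lt_irrefl _ (hML m hm1 m h)) hLc.ge hKc.ge ?_
    intro k hk l hl
    have h1 := hcol k (hK hk) m hm l (hL hl) (hKM k hk m hm1) (hML m hm1 l hl)
    have h2 := hor k (hJ' (hK hk)) m (hJ' hm) l (hJ' (hL hl)) (hKM k hk m hm1) (hML m hm1 l hl)
      (by rw [h1]; exact hcc)
    rw [ecount_213, A.Psymm l m]
    linarith

end AU

namespace AU

lemma lemU1 (ε : ℝ) (hε : 0 < ε) : ∃ n : ℕ, ∃ ν : ℝ, 0 < ν ∧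
    ∀ (A : ReducedHG) (J : Finset ℕ), A.Wicked ε → J ⊆ A.I → n ≤ J.card →
    ∀ Φ Ψ Ω : Finset ℕ, A.IsHoleW ν (1/3 + ε) J Φ → A.IsHoleW ν (1/3 + ε) J Ψ →
    A.IsHoleW ν (1/3 + ε) J Ω → A.HolesDisjoint ε J Φ Ψ →
    (∀ i ∈ J, ∀ j ∈ J, i < j → ε * ((A.P i j).card : ℝ) ≤ ((Φ ∩ Ω ∩ A.P i j).card : ℝ)) →
    (∀ i ∈ J, ∀ j ∈ J, i < j → ε * ((A.P i j).card : ℝ) ≤ ((Ψ ∩ Ω ∩ A.P i j).card : ℝ)) →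
    False := by
  obtain ⟨n, ν, hν, hF⟩ := lemF ε ε hε hε
  refine ⟨n, min ν (ν * ε), lt_min hν (by positivity), ?_⟩
  intro A J hA hJ hJn Φ Ψ Ω hΦ hΨ hΩ hdis h1 h2
  have hνε : min ν (ν * ε) / ε ≤ ν := by
    rw [div_le_iff₀ hε]; exact min_le_right _ _
  have hcomm : ∀ H i j, (Ω ∩ A.P i j) ∩ H = H ∩ Ω ∩ A.P i j := by
    intro H i j; ext x; simp only [Finset.mem_inter]; tauto
  refine hF A J hA hJ hJn Φ Ψ (IsHoleW.mono hΦ (min_le_left _ _) (Finset.Subset.refl _))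
    (IsHoleW.mono hΨ (min_le_left _ _) (Finset.Subset.refl _)) hdis (fun i j => Ω ∩ A.P i j)
    (fun i _ j _ _ => Finset.inter_subset_right)
    (fun i hi j hj hij => by rw [hcomm]; exact h1 i hi j hj hij)
    (fun i hi j hj hij => by rw [hcomm]; exact h2 i hi j hj hij)
    (bad A ε Ω) ?_ ?_
  · intro k hk k' hk' l hl a1 a2 a3
    exact (hole_bad hε hJ hΩ.1 hk hk' hl a1 a2 a3 (Finset.Subset.refl _)
      (Finset.Subset.refl _)).trans (mul_le_mul_of_nonneg_right hνε (by positivity))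
  · intro k hk k' hk' l hl m hm a1 a2 a3 a4 a5 a6 x hx x' hx' y hy y' hy' b1 b2
    exact good_inter hA.1 hJ hΩ hk hk' hl hm a1 a2 a3 a4 a5 (Finset.mem_inter.1 hx).2
      (Finset.mem_inter.1 hx').2 (Finset.mem_inter.1 hy).2 (Finset.mem_inter.1 hy').2 b1 b2

lemma disjSmall (S P : Finset ℕ) (hS : S.Nonempty) (F G : ℕ → Finset ℕ) (ε : ℝ)
    (hF : ∀ a ∈ S, F a ⊆ P) (hG : ∀ a ∈ S, G a ⊆ P)
    (dF : ∀ a ∈ S, ∀ b ∈ S, a ≠ b → ∀ z ∈ F a, z ∉ F b)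
    (dG : ∀ a ∈ S, ∀ b ∈ S, a ≠ b → ∀ z ∈ G a, z ∉ G b)
    (h2 : 2 ≤ ε * (S.card : ℝ)) :
    ∃ a ∈ S, ((F a).card : ℝ) + ((G a).card : ℝ) ≤ ε * (P.card : ℝ) := by
  have key : ∀ F : ℕ → Finset ℕ, (∀ a ∈ S, F a ⊆ P) →
      (∀ a ∈ S, ∀ b ∈ S, a ≠ b → ∀ z ∈ F a, z ∉ F b) →
      ∑ a ∈ S, ((F a).card : ℝ) ≤ P.card := by
    intro F hF dF
    have h1 : (S.biUnion F).card = ∑ a ∈ S, (F a).card := by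
      apply Finset.card_biUnion
      intro a ha b hb hab
      exact Finset.disjoint_left.2 (fun z hz hz' => dF a ha b hb hab z hz hz')
    have h2 : (S.biUnion F).card ≤ P.card := Finset.card_le_card (Finset.biUnion_subset.2 hF)
    rw [h1] at h2; exact_mod_cast h2
  by_contra hcon
  push Not at hcon
  have h3 := Finset.sum_lt_sum_of_nonempty hS hcon
  rw [Finset.sum_const, nsmul_eq_mul, Finset.sum_add_distrib] at h3
  have h4 := key F hF dF
  have h5 := key G hG dG
  have h6 : (0 : ℝ) ≤ P.card := by positivity
  nlinarith

lemma coverPairs {α : Type*} (Q : Finset α) (P : α → Finset ℕ) (r : α → ℕ → ℕ → Prop)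
    (L : Finset ℕ) (hP : ∀ q ∈ Q, (P q).Nonempty)
    (h : ∀ q ∈ Q, ∀ l ∈ L, 1 / 3 * ((P q).card : ℝ) ≤ (((P q).filter (fun z => r q l z)).card : ℝ)) :
    ∃ L' ⊆ L, (L.card : ℝ) ≤ 3 ^ Q.card * (L'.card : ℝ) ∧
      ∀ q ∈ Q, ∃ z ∈ P q, ∀ l ∈ L', r q l z := by
  induction Q using Finset.induction_on with
  | empty => exact ⟨L, Finset.Subset.refl _, by simp, by simp⟩
  | insert q Q hq ih =>
    obtain ⟨L1, h1, h2, h3⟩ := ih (fun q hq => hP q (Finset.mem_insert_of_mem hq))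
      (fun q hq => h q (Finset.mem_insert_of_mem hq))
    obtain ⟨z, hz, L2, h4, h5, h6⟩ := coverE L1 (P q) (fun l z => r q l z) (1/3)
      (hP q (Finset.mem_insert_self _ _))
      (fun l hl => h q (Finset.mem_insert_self _ _) l (h1 hl))
    refine ⟨L2, h4.trans h1, ?_, ?_⟩
    · rw [Finset.card_insert_of_notMem hq, pow_succ]
      refine h2.trans ?_
      rw [mul_assoc]
      gcongr
      linarith
    · intro p hp
      rcases Finset.mem_insert.1 hp with rfl | hp
      · exact ⟨z, hz, h6⟩
      · obtain ⟨w, hw, hw'⟩ := h3 p hp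
        exact ⟨w, hw, fun l hl => hw' l (h4 hl)⟩

/-- common neighbourhood of the vertices `s l a`, `s l' a`, `a ∈ M` -/
def cn (A : ReducedHG) (M : Finset ℕ) (s : ℕ → ℕ → ℕ) (l l' : ℕ) : Finset ℕ :=
  (A.P l l').filter (fun z => ∀ a ∈ M, z ∈ A.nbhd l l' (s l a) (s l' a))

lemma mem_cn {A : ReducedHG} {M : Finset ℕ} {s : ℕ → ℕ → ℕ} {l l' z : ℕ} :
    z ∈ cn A M s l l' ↔ z ∈ A.P l l' ∧ ∀ a ∈ M, z ∈ A.nbhd l l' (s l a) (s l' a) := by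
  simp [cn]

lemma lemEnd (ε c : ℝ) (hε : 0 < ε) (hc : 0 < c) (N : ℕ) : ∃ n : ℕ, ∃ ν : ℝ, 0 < ν ∧
    ∀ (A : ReducedHG) (J L M : Finset ℕ), A.Wicked ε → J ⊆ A.I → L ⊆ J → M ⊆ J →
    (∀ l ∈ L, ∀ m ∈ M, l ≠ m) → n ≤ L.card → M.card ≤ N → 2 ≤ ε * (M.card : ℝ) →
    ∀ H Ψ : Finset ℕ, A.IsHoleW ν (1/3 + ε) J H → A.IsHoleW ν (1/3 + ε) J Ψ →
    A.HolesDisjoint ε J H Ψ →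
    ∀ s : ℕ → ℕ → ℕ, (∀ l ∈ L, ∀ m ∈ M, s l m ∈ A.P l m) →
    (∀ i ∈ L, ∀ j ∈ L, i < j → c * ((A.P i j).card : ℝ) ≤ ((cn A M s i j ∩ H).card : ℝ)) →
    (∀ i ∈ L, ∀ j ∈ L, i < j → c * ((A.P i j).card : ℝ) ≤ ((cn A M s i j ∩ Ψ).card : ℝ)) →
    False := by
  obtain ⟨n, ν, hν, hF⟩ := lemF ε c hε hc
  refine ⟨3 ^ (N * N) * n, ν, hν, ?_⟩
  intro A J L M hA hJ hL hM hLM hLn hMN hMε H Ψ hH hΨ hdis s hs h1 h2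
  have hMne : M.Nonempty := by
    rw [Finset.nonempty_iff_ne_empty]
    rintro rfl
    simp at hMε
    linarith
  obtain ⟨L3, hL3, hL3c, hz⟩ := coverPairs M.offDiag (fun q => A.P q.1 q.2)
    (fun q l z => A.Edge (s l q.1) (s l q.2) z) L
    (fun q hq => by
      rw [Finset.mem_offDiag] at hq
      exact A.Pnonempty _ _ (hJ (hM hq.1)) (hJ (hM hq.2.1)) hq.2.2)
    (fun q hq l hl => by
      rw [Finset.mem_offDiag] at hq
      have := deg hA.1 (hJ (hM hq.1)) (hJ (hM hq.2.1)) (hJ (hL hl)) hq.2.2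
        (hLM l hl _ hq.1).symm (hLM l hl _ hq.2.1).symm
        (by rw [A.Psymm]; exact hs l hl _ hq.1) (by rw [A.Psymm]; exact hs l hl _ hq.2.1)
      have h0 : (0 : ℝ) ≤ ε * (A.P q.1 q.2).card := by positivity
      have e : A.nbhd q.1 q.2 (s l q.1) (s l q.2) =
        (A.P q.1 q.2).filter (fun z => A.Edge (s l q.1) (s l q.2) z) := rfl
      rw [← e]
      linarith)
  have hL3n : n ≤ L3.card := by
    have h3 : (3 : ℝ) ^ M.offDiag.card ≤ 3 ^ (N * N) := by
      apply pow_le_pow_right₀ (by norm_num)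
      rw [Finset.offDiag_card]
      exact (Nat.sub_le _ _).trans (Nat.mul_le_mul hMN hMN)
    have h4 : ((3 ^ (N * N) * n : ℕ) : ℝ) ≤ L.card := by exact_mod_cast hLn
    push_cast at h4
    have h5 : (3 : ℝ) ^ (N * N) * n ≤ 3 ^ (N * N) * L3.card :=
      h4.trans (hL3c.trans (by gcongr))
    have h6 := le_of_mul_le_mul_left h5 (by positivity)
    exact_mod_cast h6
  have hLJ : L3 ⊆ J := hL3.trans hL
  have hLI : L3 ⊆ A.I := hLJ.trans hJ
  have hMI : M ⊆ A.I := hM.trans hJ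
  have hsub : ∀ i j, cn A M s i j ⊆ A.P i j := fun i j => Finset.filter_subset _ _
  -- disjointness from the absence of a clique
  have hdj : ∀ k ∈ L3, ∀ k' ∈ L3, ∀ l ∈ L3, k ≠ k' → k ≠ l → k' ≠ l →
      ∀ x ∈ cn A M s k l, ∀ x' ∈ cn A M s k' l, ∀ a ∈ M, ∀ a' ∈ M, a ≠ a' →
      ∀ w ∈ A.nbhd k k' x x' ∩ A.nbhd k k' (s k a) (s k' a),
        w ∉ A.nbhd k k' x x' ∩ A.nbhd k k' (s k a') (s k' a') := by
    intro k hk k' hk' l hl n1 n2 n3 x hx x' hx' a ha a' ha' naa w hw hw'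
    apply hA.2
    obtain ⟨z, hzP, hzE⟩ := hz (a, a') (Finset.mem_offDiag.2 ⟨ha, ha', naa⟩)
    simp only at hzP hzE
    rw [Finset.mem_inter, mem_nbhd, mem_nbhd] at hw hw'
    rw [mem_cn] at hx hx'
    have xa := (mem_nbhd.1 (hx.2 a ha)).2
    have xa' := (mem_nbhd.1 (hx.2 a' ha')).2
    have ya := (mem_nbhd.1 (hx'.2 a ha)).2
    have ya' := (mem_nbhd.1 (hx'.2 a' ha')).2
    have rot : ∀ {p q r : ℕ}, A.Edge p q r → A.Edge r p q := fun h =>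
      A.EdgeSymm _ _ _ (A.EdgeSymm' _ _ _ h)
    exact K5of A k k' l a a' (hLI hk) (hLI hk') (hLI hl) (hMI ha) (hMI ha') n1 n2
      (hLM k (hL3 hk) a ha) (hLM k (hL3 hk) a' ha') n3
      (hLM k' (hL3 hk') a ha) (hLM k' (hL3 hk') a' ha') (hLM l (hL3 hl) a ha)
      (hLM l (hL3 hl) a' ha') naa
      w x (s k a) (s k a') x' (s k' a) (s k' a') (s l a) (s l a') z
      hw.1.1 hx.1 (hs k (hL3 hk) a ha) (hs k (hL3 hk) a' ha') hx'.1
      (hs k' (hL3 hk') a ha) (hs k' (hL3 hk') a' ha') (hs l (hL3 hl) a ha) (hs l (hL3 hl) a' ha')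
      hzP (rot hw.1.2) (rot hw.2.2) (rot hw'.2.2) (rot xa) (rot xa') (hzE k hk)
      (rot ya) (rot ya') (hzE k' hk') (hzE l hl)
  refine hF A L3 hA hLI hL3n H Ψ (IsHoleW.mono hH le_rfl hLJ) (IsHoleW.mono hΨ le_rfl hLJ)
    (fun i hi j hj => hdis i (hLJ hi) j (hLJ hj)) (cn A M s) (fun i _ j _ _ => hsub i j)
    (fun i hi j hj => h1 i (hL3 hi) j (hL3 hj)) (fun i hi j hj => h2 i (hL3 hi) j (hL3 hj))
    (fun _ _ _ _ => False) ?_ ?_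
  · intro k hk k' hk' l hl _ _ _
    simp only [Finset.filter_false, Finset.card_empty, Nat.cast_zero]
    positivity
  · intro k hk k' hk' l hl m hm n1 n2 n3 n4 n5 n6 x hx x' hx' y hy y' hy' _ _
    obtain ⟨a, ha, hsm⟩ := disjSmall M (A.P k k') hMne
      (fun a => A.nbhd k k' x x' ∩ A.nbhd k k' (s k a) (s k' a))
      (fun a => A.nbhd k k' y y' ∩ A.nbhd k k' (s k a) (s k' a)) ε
      (fun a _ => Finset.inter_subset_left.trans (nbhd_sub _ _ _ _ _))
      (fun a _ => Finset.inter_subset_left.trans (nbhd_sub _ _ _ _ _))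
      (hdj k hk k' hk' l hl n1 n2 n3 x hx x' hx') (hdj k hk k' hk' m hm n1 n4 n5 y hy y' hy') hMε
    have t := three (A.P k k') _ _ _ ε (nbhd_sub A k k' x x') (nbhd_sub A k k' y y')
      (nbhd_sub A k k' (s k a) (s k' a))
      (deg hA.1 (hLI hk) (hLI hk') (hLI hl) n1 n2 n3 (hsub _ _ hx) (hsub _ _ hx'))
      (deg hA.1 (hLI hk) (hLI hk') (hLI hm) n1 n4 n5 (hsub _ _ hy) (hsub _ _ hy'))
      (deg hA.1 (hLI hk) (hLI hk') (hMI ha) n1 (hLM k (hL3 hk) a ha) (hLM k' (hL3 hk') a ha)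
        (hs k (hL3 hk) a ha) (hs k' (hL3 hk') a ha))
    have h0 : (0 : ℝ) ≤ ε * (A.P k k').card := by positivity
    linarith

lemma pairM (ε : ℝ) (hε : 0 < ε) (P M H Ψ : Finset ℕ) (hP : P.Nonempty) (hM : M.Nonempty)
    (Λ : ℕ → Finset ℕ) (hΛ : ∀ m ∈ M, Λ m ⊆ P)
    (h1 : ∀ m ∈ M, ε * (P.card : ℝ) ≤ ((Λ m ∩ H).card : ℝ))
    (h2 : ∀ m ∈ M, ε * (P.card : ℝ) ≤ ((Λ m ∩ Ψ).card : ℝ)) :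
    ∃ M1 ⊆ M, ε ^ 2 / 2 * (M.card : ℝ) ≤ (M1.card : ℝ) ∧
      (∀ D : Finset ℕ, (∀ z ∈ P, (∀ m ∈ M1, z ∈ Λ m) → z ∈ D) →
        ε ^ 2 / 2 / 2 ^ M.card * (P.card : ℝ) ≤ ((D ∩ H).card : ℝ) ∧
        ε ^ 2 / 2 / 2 ^ M.card * (P.card : ℝ) ≤ ((D ∩ Ψ).card : ℝ)) := by
  have hPp : (0 : ℝ) < P.card := by exact_mod_cast Finset.card_pos.2 hP
  obtain ⟨G, hG, hG1, hG2⟩ := avgS M ((P ∩ H) ×ˢ (P ∩ Ψ)) (fun m p => p.1 ∈ Λ m ∧ p.2 ∈ Λ m)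
    ((P.card : ℝ) * P.card) (ε ^ 2) hM (by positivity) (by
      rw [Finset.card_product]
      push_cast
      gcongr <;> exact Finset.inter_subset_left) (by
      intro m hm
      refine ⟨(Λ m ∩ H) ×ˢ (Λ m ∩ Ψ), ?_, ?_, ?_⟩
      · exact Finset.product_subset_product (Finset.inter_subset_inter_right (hΛ m hm))
          (Finset.inter_subset_inter_right (hΛ m hm))
      · rw [Finset.card_product]
        push_cast
        calc ε ^ 2 * ((P.card : ℝ) * P.card) = (ε * P.card) * (ε * P.card) := by ring
          _ ≤ _ := by
            have := h1 m hm
            have := h2 m hm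
            gcongr
      · intro p hp
        rw [Finset.mem_product, Finset.mem_inter, Finset.mem_inter] at hp
        exact ⟨hp.1.1, hp.2.1⟩)
  have hGne : G.Nonempty := by
    rw [← Finset.card_pos]
    have : (0 : ℝ) < G.card := lt_of_lt_of_le (by positivity) hG1
    exact_mod_cast this
  obtain ⟨K1, hK1, M1, hM1, hKc, hMc, hr⟩ := biq' G M (fun p m => p.1 ∈ Λ m ∧ p.2 ∈ Λ m)
    (ε ^ 2 / 2 * (M.card : ℝ)) hGne (by
      intro p hp
      convert hG2 p hp)
  refine ⟨M1, hM1, hMc, fun D hD => ?_⟩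
  have hbig : ε ^ 2 / 2 / 2 ^ M.card * ((P.card : ℝ) * P.card) ≤ K1.card := by
    have := hG1.trans hKc
    rw [div_mul_eq_mul_div, div_le_iff₀ (by positivity)]
    linarith
  have hsub : ∀ p ∈ K1, p.1 ∈ D ∩ H ∧ p.2 ∈ D ∩ Ψ := by
    intro p hp
    have h3 := Finset.mem_product.1 (hG (hK1 hp))
    rw [Finset.mem_inter, Finset.mem_inter] at h3
    rw [Finset.mem_inter, Finset.mem_inter]
    exact ⟨⟨hD _ h3.1.1 (fun m hm => (hr p hp m hm).1), h3.1.2⟩,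
      ⟨hD _ h3.2.1 (fun m hm => (hr p hp m hm).2), h3.2.2⟩⟩
  have hKP : ∀ p ∈ K1, p.1 ∈ P ∧ p.2 ∈ P := by
    intro p hp
    have h3 := Finset.mem_product.1 (hG (hK1 hp))
    rw [Finset.mem_inter, Finset.mem_inter] at h3
    exact ⟨h3.1.1, h3.2.1⟩
  constructor
  · have h4 : K1.card ≤ (D ∩ H).card * P.card := by
      rw [← Finset.card_product]
      exact Finset.card_le_card (fun p hp => Finset.mem_product.2 ⟨(hsub p hp).1, (hKP p hp).2⟩)
    have h5 : (K1.card : ℝ) ≤ (D ∩ H).card * P.card := by exact_mod_cast h4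
    refine le_of_mul_le_mul_right ?_ hPp
    linarith
  · have h4 : K1.card ≤ P.card * (D ∩ Ψ).card := by
      rw [← Finset.card_product]
      exact Finset.card_le_card (fun p hp => Finset.mem_product.2 ⟨(hKP p hp).1, (hsub p hp).2⟩)
    have h5 : (K1.card : ℝ) ≤ P.card * (D ∩ Ψ).card := by exact_mod_cast h4
    refine le_of_mul_le_mul_right ?_ hPp
    linarith

end AU

namespace AU

lemma two_of_card {S : Finset ℕ} (h : 2 ≤ S.card) : ∃ i ∈ S, ∃ j ∈ S, i < j := by
  obtain ⟨i, hi, j, hj, hij⟩ := Finset.one_lt_card.1 (by omega : 1 < S.card)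
  rcases lt_or_gt_of_ne hij with h | h
  · exact ⟨i, hi, j, hj, h⟩
  · exact ⟨j, hj, i, hi, h⟩

lemma bad_symm (A : ReducedHG) (ε : ℝ) (H : Finset ℕ) (k k' x x' : ℕ) :
    bad A ε H k k' x x' ↔ bad A ε H k' k x' x := by
  unfold bad
  rw [nbhd_symm A k k', A.Psymm k k']

lemma lemU2 (ε μ0 : ℝ) (hε : 0 < ε) (hμ0 : 0 < μ0) : ∃ n : ℕ, ∃ ν : ℝ, 0 < ν ∧
    ∀ (A : ReducedHG) (J K L M : Finset ℕ), A.Wicked ε → J ⊆ A.I → K ⊆ J → L ⊆ J → M ⊆ J →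
    (∀ k ∈ K, ∀ l ∈ L, k ≠ l) → (∀ k ∈ K, ∀ m ∈ M, k ≠ m) → (∀ l ∈ L, ∀ m ∈ M, l ≠ m) →
    n ≤ K.card → n ≤ L.card → n ≤ M.card →
    ∀ H1 H2 Ψ : Finset ℕ, A.IsHoleW ν (1/3 + ε) J H1 → A.IsHoleW ν (1/3 + ε) J H2 →
    A.IsHoleW ν (1/3 + ε) J Ψ → A.HolesDisjoint ε J H1 Ψ → A.HolesDisjoint ε J H2 Ψ →
    (∀ k ∈ K, ∀ l ∈ L, ∀ m ∈ M,
      μ0 * (((A.P k l).card : ℝ) * ((A.P k m).card : ℝ) * ((A.P l m).card : ℝ)) ≤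
        (A.ecount (H1 ∩ A.P k l) (H1 ∩ A.P k m) (H2 ∩ A.P l m) : ℝ)) → False := by
  obtain ⟨N, hN⟩ := exNat (ε ^ 2 / 2) (2 / ε) (by positivity)
  have hN0 : 0 < N := by
    rcases Nat.eq_zero_or_pos N with rfl | h
    · have : 0 < 2 / ε := by positivity
      simp at hN; linarith
    · exact h
  obtain ⟨nE, νE, hνE, hE⟩ := lemEnd ε (ε ^ 2 / 2 / 2 ^ N) hε (by positivity) N
  obtain ⟨sb, hsb⟩ := ramsey2F (γ := Finset ℕ) (2 ^ N) (nE + 2)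
  obtain ⟨nLc, nKc, νc, hνc, hC⟩ := core ε (μ0 / 4) hε (by positivity)
  obtain ⟨sa, hsa⟩ := ramsey2F (γ := Finset ℕ) (2 ^ N) (max nLc sb + 2)
  obtain ⟨νS, hνS, hS⟩ := lemS μ0 hμ0 sa N
  refine ⟨nKc + 1 + sa + N, min νE (ε * min νc νS),
    lt_min hνE (mul_pos hε (lt_min hνc hνS)), ?_⟩
  intro A J K L0 M0 hA hJ hK hL0 hM0 hKL0 hKM0 hLM0 hKn hLn hMn H1 H2 Ψ hH1 hH2 hΨ hd1 hd2 hec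
  set ν := min νE (ε * min νc νS) with hν
  have hνc' : ν / ε ≤ νc := by
    rw [div_le_iff₀ hε]
    calc ν ≤ ε * min νc νS := min_le_right _ _
      _ ≤ ε * νc := by gcongr; exact min_le_left _ _
      _ = νc * ε := by ring
  have hνS' : ν / ε ≤ νS := by
    rw [div_le_iff₀ hε]
    calc ν ≤ ε * min νc νS := min_le_right _ _
      _ ≤ ε * νS := by gcongr; exact min_le_right _ _
      _ = νS * ε := by ring
  obtain ⟨L, hLL0, hLc⟩ := Finset.exists_subset_card_eq (show sa ≤ L0.card by omega)
  obtain ⟨M, hMM0, hMc⟩ := Finset.exists_subset_card_eq (show N ≤ M0.card by omega)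
  have hL := hLL0.trans hL0
  have hM := hMM0.trans hM0
  have hKL : ∀ k ∈ K, ∀ l ∈ L, k ≠ l := fun k hk l hl => hKL0 k hk l (hLL0 hl)
  have hKM : ∀ k ∈ K, ∀ m ∈ M, k ≠ m := fun k hk l hl => hKM0 k hk l (hMM0 hl)
  have hLM : ∀ l ∈ L, ∀ m ∈ M, l ≠ m := fun k hk l hl => hLM0 k (hLL0 hk) l (hMM0 hl)
  have hMne : M.Nonempty := Finset.card_pos.1 (by omega)
  obtain ⟨s, hs1, hs2, hs3⟩ := hS A K L M (hK.trans hJ) (hL.trans hJ) (hM.trans hJ) hKL hKM hLM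
    (Finset.card_pos.1 (by omega)) hLc.le hMc.le (fun k l => H1 ∩ A.P k l)
    (fun k l => H1 ∩ A.P k l) (fun k l => H2 ∩ A.P k l)
    (fun _ _ _ _ => Finset.inter_subset_right) (fun _ _ _ _ => Finset.inter_subset_right)
    (fun _ _ _ _ => Finset.inter_subset_right)
    (fun k hk l hl m hm => hec k hk l (hLL0 hl) m (hMM0 hm)) (bad A ε H2)
    (fun l hl l' hl' hll m hm =>
      (hole_bad hε hJ hH2.1 (hL hl) (hL hl') (hM hm) hll (hLM l hl m hm) (hLM l' hl' m hm)
        (Finset.Subset.refl _) (Finset.Subset.refl _)).trans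
        (mul_le_mul_of_nonneg_right hνS' (by positivity)))
  have hsP : ∀ l ∈ L, ∀ m ∈ M, s l m ∈ A.P l m := fun l hl m hm =>
    (Finset.mem_inter.1 (hs1 l hl m hm)).2
  have hpow : M.powerset.card ≤ 2 ^ N := by rw [Finset.card_powerset, hMc]
  obtain ⟨L1, hL1, hL1c, hu⟩ := hsa L hLc.ge M.powerset hpow
    (fun l l' => M.filter (fun m => ¬ bad A ε H1 l l' (s l m) (s l' m)))
    (fun i _ j _ _ => Finset.mem_powerset.2 (Finset.filter_subset _ _))
  obtain ⟨i0, hi0, j0, hj0, hij0⟩ := two_of_card (show 2 ≤ L1.card by omega)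
  have hL1J := hL1.trans hL
  by_cases hc : ∃ m ∈ M, ¬ bad A ε H1 i0 j0 (s i0 m) (s j0 m)
  · obtain ⟨m, hm, hmb⟩ := hc
    have hmJ := hM hm
    have hgood' : ∀ l ∈ L1, ∀ l' ∈ L1, l < l' → ¬ bad A ε H1 l l' (s l m) (s l' m) := by
      intro l hl l' hl' hlt
      have h1 := hu i0 hi0 j0 hj0 l hl l' hl' hij0 hlt
      have h2 : m ∈ M.filter (fun m => ¬ bad A ε H1 l l' (s l m) (s l' m)) := by
        rw [← h1]; exact Finset.mem_filter.2 ⟨hm, hmb⟩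
      exact (Finset.mem_filter.1 h2).2
    have hgood : ∀ l ∈ L1, ∀ l' ∈ L1, l ≠ l' → ¬ bad A ε H1 l l' (s l m) (s l' m) := by
      intro l hl l' hl' hne
      rcases lt_or_gt_of_ne hne with h | h
      · exact hgood' l hl l' hl' h
      · rw [bad_symm]; exact hgood' l' hl' l hl h
    refine hA.2 (hC A m K L1 (hJ hmJ) (hK.trans hJ) (hL1J.trans hJ)
      (fun k hk l hl => hKL k hk l (hL1 hl)) (fun h => hKM m h m hm rfl)
      (fun h => hLM m (hL1 h) m hm rfl) (by omega) (by omega) (fun l => s l m)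
      (fun k l => H1 ∩ A.P k l) (fun k => H1 ∩ A.P k m)
      (fun l hl => hsP l (hL1 hl) m hm) (fun _ _ _ _ => Finset.inter_subset_right)
      (fun _ _ => Finset.inter_subset_right) (fun l hl => hs3 m hm l (hL1 hl))
      (bad A ε H1) (bad A ε H1) ?_ ?_ ?_ ?_ ?_)
    · intro k hk k' hk' hkk l hl
      exact (hole_bad hε hJ hH1.1 (hK hk) (hK hk') (hL1J hl) hkk (hKL k hk l (hL1 hl))
        (hKL k' hk' l (hL1 hl)) (Finset.Subset.refl _) (Finset.Subset.refl _)).trans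
        (mul_le_mul_of_nonneg_right hνc' (by positivity))
    · intro k hk k' hk' hkk
      exact (hole_bad hε hJ hH1.1 (hK hk) (hK hk') hmJ hkk (hKM k hk m hm)
        (hKM k' hk' m hm) (Finset.Subset.refl _) (Finset.Subset.refl _)).trans
        (mul_le_mul_of_nonneg_right hνc' (by positivity))
    · intro l hl l' hl' hll k hk
      have := (hole_bad hε hJ hH1.1 (hL1J hl) (hL1J hl') (hK hk) hll (hKL k hk l (hL1 hl)).symm
        (hKL k hk l' (hL1 hl')).symm (Finset.Subset.refl _) (Finset.Subset.refl _)).trans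
        (mul_le_mul_of_nonneg_right hνc' (by positivity))
      rw [A.Psymm l k, A.Psymm l' k] at this
      exact this
    · intro k hk k' hk' hkk l hl x hx x' hx' y hy y' hy' b1 b2
      exact good_inter hA.1 hJ hH1 (hK hk) (hK hk') (hL1J hl) hmJ hkk (hKL k hk l (hL1 hl))
        (hKL k' hk' l (hL1 hl)) (hKM k hk m hm) (hKM k' hk' m hm) (Finset.mem_inter.1 hx).2
        (Finset.mem_inter.1 hx').2 (Finset.mem_inter.1 hy).2 (Finset.mem_inter.1 hy').2 b1 b2
    · intro l hl l' hl' hll k hk x hx x' hx' b1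
      have hx := (Finset.mem_inter.1 hx).2
      have hx' := (Finset.mem_inter.1 hx').2
      rw [A.Psymm] at hx hx'
      exact good_inter hA.1 hJ hH1 (hL1J hl) (hL1J hl') (hK hk) hmJ hll (hKL k hk l (hL1 hl)).symm
        (hKL k hk l' (hL1 hl')).symm (hLM l (hL1 hl) m hm) (hLM l' (hL1 hl') m hm) hx hx'
        (hsP l (hL1 hl) m hm) (hsP l' (hL1 hl') m hm) b1 (hgood l hl l' hl' hll)
  · push Not at hc
    have hbad : ∀ l ∈ L1, ∀ l' ∈ L1, l < l' → ∀ m ∈ M, bad A ε H1 l l' (s l m) (s l' m) := by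
      intro l hl l' hl' hlt m hm
      by_contra hcon
      have h1 := hu i0 hi0 j0 hj0 l hl l' hl' hij0 hlt
      have h2 : m ∈ M.filter (fun m => ¬ bad A ε H1 i0 j0 (s i0 m) (s j0 m)) := by
        rw [h1]; exact Finset.mem_filter.2 ⟨hm, hcon⟩
      exact (Finset.mem_filter.1 h2).2 (hc m hm)
    have hex : ∀ l l', ∃ M1 ⊆ M, l ∈ L1 → l' ∈ L1 → l < l' →
        ε ^ 2 / 2 * (M.card : ℝ) ≤ (M1.card : ℝ) ∧
        ε ^ 2 / 2 / 2 ^ N * ((A.P l l').card : ℝ) ≤ ((cn A M1 s l l' ∩ H1).card : ℝ) ∧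
        ε ^ 2 / 2 / 2 ^ N * ((A.P l l').card : ℝ) ≤ ((cn A M1 s l l' ∩ Ψ).card : ℝ) := by
      intro l l'
      by_cases hll : l ∈ L1 ∧ l' ∈ L1 ∧ l < l'
      · obtain ⟨hl, hl', hlt⟩ := hll
        obtain ⟨M1, hM1, hM1c, hD⟩ := pairM ε hε (A.P l l') M H1 Ψ
          (A.Pnonempty l l' (hJ (hL1J hl)) (hJ (hL1J hl')) hlt.ne) hMne
          (fun m => A.nbhd l l' (s l m) (s l' m)) (fun m _ => nbhd_sub A _ _ _ _)
          (fun m hm => (hbad l hl l' hl' hlt m hm).le) (by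
            intro m hm
            have h1 := two_meet (A.P l l') H2 Ψ (A.nbhd l l' (s l m) (s l' m)) ε
              (nbhd_sub A _ _ _ _)
              (deg hA.1 (hJ (hL1J hl)) (hJ (hL1J hl')) (hJ (hM hm)) hlt.ne
                (hLM l (hL1 hl) m hm) (hLM l' (hL1 hl') m hm) (hsP l (hL1 hl) m hm)
                (hsP l' (hL1 hl') m hm))
              (hH2.2 l (hL1J hl) l' (hL1J hl') hlt.ne) (hΨ.2 l (hL1J hl) l' (hL1J hl') hlt.ne)
              (hd2 l (hL1J hl) l' (hL1J hl') hlt.ne)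
            have h2 := hs2 l (hL1 hl) l' (hL1 hl') hlt.ne m hm
            unfold bad at h2
            push Not at h2
            linarith)
        refine ⟨M1, hM1, fun _ _ _ => ⟨hM1c, ?_⟩⟩
        have := hD (cn A M1 s l l') (fun z hz h => mem_filter.2 ⟨hz, h⟩)
        rw [hMc] at this
        exact this
      · exact ⟨∅, Finset.empty_subset _, fun a b c => absurd ⟨a, b, c⟩ hll⟩
    choose F hF1 hF2 using hex
    obtain ⟨L2, hL2, hL2c, hu2⟩ := hsb L1 (by omega) M.powerset hpow F
      (fun i _ j _ _ => Finset.mem_powerset.2 (hF1 i j))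
    obtain ⟨i1, hi1, j1, hj1, hij1⟩ := two_of_card (show 2 ≤ L2.card by omega)
    have hM1 := hF1 i1 j1
    have hM1c := (hF2 i1 j1 (hL2 hi1) (hL2 hj1) hij1).1
    have hLJ2 := hL2.trans hL1J
    refine hE A J L2 (F i1 j1) hA hJ hLJ2 (hM1.trans hM)
      (fun l hl m hm => hLM l (hL1 (hL2 hl)) m (hM1 hm)) (by omega)
      ((Finset.card_le_card hM1).trans hMc.le) ?_ H1 Ψ
      (IsHoleW.mono hH1 (min_le_left _ _) (Finset.Subset.refl _))
      (IsHoleW.mono hΨ (min_le_left _ _) (Finset.Subset.refl _)) hd1 s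
      (fun l hl m hm => hsP l (hL1 (hL2 hl)) m (hM1 hm)) ?_ ?_
    · rw [hMc] at hM1c
      have := hN.trans hM1c
      rw [div_le_iff₀ hε] at this
      linarith
    · intro i hi j hj hij
      rw [hu2 i1 hi1 j1 hj1 i hi j hj hij1 hij]
      exact (hF2 i j (hL2 hi) (hL2 hj) hij).2.1
    · intro i hi j hj hij
      rw [hu2 i1 hi1 j1 hj1 i hi j hj hij1 hij]
      exact (hF2 i j (hL2 hi) (hL2 hj) hij).2.2

end AU

namespace AU

/-- many edges in the pattern `X, Y, Z` -/
def pat (A : ReducedHG) (μ0 : ℝ) (X Y Z : Finset ℕ) (i j k : ℕ) : Prop :=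
  μ0 * (((A.P i j).card : ℝ) * ((A.P i k).card : ℝ) * ((A.P j k).card : ℝ)) ≤
    (A.ecount (X ∩ A.P i j) (Y ∩ A.P i k) (Z ∩ A.P j k) : ℝ)

lemma noPat (ε μ0 : ℝ) (hε : 0 < ε) (hμ0 : 0 < μ0) : ∃ n : ℕ, ∃ ν : ℝ, 0 < ν ∧
    ∀ (A : ReducedHG) (J : Finset ℕ), A.Wicked ε → J ⊆ A.I → n ≤ J.card →
    ∀ H1 H2 Ψ : Finset ℕ, A.IsHoleW ν (1/3 + ε) J H1 → A.IsHoleW ν (1/3 + ε) J H2 →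
    A.IsHoleW ν (1/3 + ε) J Ψ → A.HolesDisjoint ε J H1 Ψ → A.HolesDisjoint ε J H2 Ψ →
    ¬ (∀ i ∈ J, ∀ j ∈ J, ∀ k ∈ J, i < j → j < k → pat A μ0 H1 H1 H2 i j k) ∧
    ¬ (∀ i ∈ J, ∀ j ∈ J, ∀ k ∈ J, i < j → j < k → pat A μ0 H1 H2 H1 i j k) ∧
    ¬ (∀ i ∈ J, ∀ j ∈ J, ∀ k ∈ J, i < j → j < k → pat A μ0 H2 H1 H1 i j k) := by
  obtain ⟨n, ν, hν, h⟩ := lemU2 ε μ0 hε hμ0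
  refine ⟨n + n + n, ν, hν, ?_⟩
  intro A J hA hJ hJn H1 H2 Ψ h1 h2 h3 d1 d2
  obtain ⟨B, hB, C, hC, D, hD, cB, cC, cD, hBC, hBD, hCD⟩ := blocks n n n J hJn
  refine ⟨fun hp => ?_, fun hp => ?_, fun hp => ?_⟩
  · refine h A J B C D hA hJ hB hC hD (fun a ha b hb => (hBC a ha b hb).ne)
      (fun a ha b hb => (hBD a ha b hb).ne) (fun a ha b hb => (hCD a ha b hb).ne)
      cB.ge cC.ge cD.ge H1 H2 Ψ h1 h2 h3 d1 d2 ?_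
    intro i hi j hj k hk
    exact hp i (hB hi) j (hC hj) k (hD hk) (hBC i hi j hj) (hCD j hj k hk)
  · refine h A J C B D hA hJ hC hB hD (fun a ha b hb => (hBC b hb a ha).ne')
      (fun a ha b hb => (hCD a ha b hb).ne) (fun a ha b hb => (hBD a ha b hb).ne)
      cC.ge cB.ge cD.ge H1 H2 Ψ h1 h2 h3 d1 d2 ?_
    intro j hj i hi k hk
    have := hp i (hB hi) j (hC hj) k (hD hk) (hBC i hi j hj) (hCD j hj k hk)
    unfold pat at this
    rw [A.Psymm j i, ecount_132]
    exact le_trans (le_of_eq (by ring)) this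
  · refine h A J D B C hA hJ hD hB hC (fun a ha b hb => (hBD b hb a ha).ne')
      (fun a ha b hb => (hCD b hb a ha).ne') (fun a ha b hb => (hBC a ha b hb).ne)
      cD.ge cB.ge cC.ge H1 H2 Ψ h1 h2 h3 d1 d2 ?_
    intro k hk i hi j hj
    have := hp i (hB hi) j (hC hj) k (hD hk) (hBC i hi j hj) (hCD j hj k hk)
    unfold pat at this
    rw [ecount_213, ecount_132] at this
    rw [A.Psymm k i, A.Psymm k j]
    exact le_trans (le_of_eq (by ring)) this

lemma ecount_union8 (A : ReducedHG) (X X' Y Y' Z Z' : Finset ℕ) :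
    A.ecount (X ∪ X') (Y ∪ Y') (Z ∪ Z') ≤
      A.ecount X Y Z + A.ecount X Y Z' + A.ecount X Y' Z + A.ecount X Y' Z' +
      A.ecount X' Y Z + A.ecount X' Y Z' + A.ecount X' Y' Z + A.ecount X' Y' Z' := by
  have u3 : ∀ X Y, A.ecount X Y (Z ∪ Z') ≤ A.ecount X Y Z + A.ecount X Y Z' := by
    intro X Y
    rw [ecount_132, ecount_213, ecount_132 A X Y Z, ecount_213 A X Z, ecount_132 A X Y Z',
      ecount_213 A X Z']
    exact ecount_union _ _ _ _ _
  have u2 : ∀ X, A.ecount X (Y ∪ Y') (Z ∪ Z') ≤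
      A.ecount X Y (Z ∪ Z') + A.ecount X Y' (Z ∪ Z') := by
    intro X
    rw [ecount_213, ecount_213 A X Y, ecount_213 A X Y']
    exact ecount_union _ _ _ _ _
  have := ecount_union A X X' (Y ∪ Y') (Z ∪ Z')
  have := u2 X
  have := u2 X'
  have := u3 X Y
  have := u3 X Y'
  have := u3 X' Y
  have := u3 X' Y'
  omega

/-- the hole condition for sorted triples suffices -/
lemma hole_sorted (A : ReducedHG) (μ : ℝ) (J H : Finset ℕ)
    (h : ∀ i ∈ J, ∀ j ∈ J, ∀ k ∈ J, i < j → j < k →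
      (A.ecount (H ∩ A.P i j) (H ∩ A.P i k) (H ∩ A.P j k) : ℝ) ≤
        μ * (((A.P i j).card : ℝ) * ((A.P i k).card : ℝ) * ((A.P j k).card : ℝ))) :
    ∀ i ∈ J, ∀ j ∈ J, ∀ k ∈ J, i ≠ j → i ≠ k → j ≠ k →
      (A.ecount (H ∩ A.P i j) (H ∩ A.P i k) (H ∩ A.P j k) : ℝ) ≤
        μ * (((A.P i j).card : ℝ) * ((A.P i k).card : ℝ) * ((A.P j k).card : ℝ)) := by
  set Q : ℕ → ℕ → ℕ → Prop := fun i j k =>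
    (A.ecount (H ∩ A.P i j) (H ∩ A.P i k) (H ∩ A.P j k) : ℝ) ≤
        μ * (((A.P i j).card : ℝ) * ((A.P i k).card : ℝ) * ((A.P j k).card : ℝ)) with hQ
  have s1 : ∀ i j k, Q i j k → Q j i k := by
    intro i j k hq
    simp only [hQ] at hq ⊢
    rw [A.Psymm j i, ecount_132]
    exact hq.trans (le_of_eq (by ring))
  have s2 : ∀ i j k, Q i j k → Q i k j := by
    intro i j k hq
    simp only [hQ] at hq ⊢
    rw [A.Psymm k j, ecount_213]
    exact hq.trans (le_of_eq (by ring))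
  intro i hi j hj k hk h1 h2 h3
  change Q i j k
  rcases lt_or_gt_of_ne h1 with h1 | h1 <;> rcases lt_or_gt_of_ne h2 with h2 | h2 <;>
    rcases lt_or_gt_of_ne h3 with h3 | h3
  · exact h i hi j hj k hk h1 h3
  · exact s2 _ _ _ (h i hi k hk j hj h2 h3)
  · omega
  · exact s2 _ _ _ (s1 _ _ _ (h k hk i hi j hj h2 h1))
  · exact s1 _ _ _ (h j hj i hi k hk h1 h2)
  · omega
  · exact s1 _ _ _ (s2 _ _ _ (h j hj k hk i hi h3 h2))
  · exact s1 _ _ _ (s2 _ _ _ (s1 _ _ _ (h k hk j hj i hi h3 h1)))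

lemma filter_inter_eq (A : ReducedHG) (H : Finset ℕ) (j k x y : ℕ) :
    (H ∩ A.P j k).filter (fun z => A.Edge x y z) = A.nbhd j k x y ∩ H := by
  ext z
  simp only [Finset.mem_filter, Finset.mem_inter, mem_nbhd]
  tauto

set_option maxHeartbeats 2000000 in
lemma branch (μ ε : ℝ) (hμ : 0 < μ) (hε : 0 < ε) : ∃ ν : ℝ, 0 < ν ∧ ∀ t : ℕ, ∃ s : ℕ,
    ∀ (A : ReducedHG) (J : Finset ℕ), A.Wicked ε → J ⊆ A.I → s ≤ J.card →
    ∀ Φ Ψ Ω : Finset ℕ, A.IsHoleW ν (1/3 + ε) J Φ → A.IsHoleW ν (1/3 + ε) J Ψ →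
    A.IsHoleW ν (1/3 + ε) J Ω → A.HolesDisjoint ε J Φ Ψ → A.HolesDisjoint ε J Ω Ψ →
    ∃ Js ⊆ J, t ≤ Js.card ∧ A.IsHoleW μ (1/3 + ε) Js (Φ ∪ Ω) ∧
      A.HolesDisjoint ε Js (Φ ∪ Ω) Ψ := by
  set μ' := min μ (ε ^ 3) with hμ'
  have hμ'0 : 0 < μ' := lt_min hμ (by positivity)
  have hμ'1 : μ' ≤ μ := min_le_left _ _
  have hμ'2 : μ' ≤ ε ^ 3 := min_le_right _ _
  obtain ⟨n, ν0, hν0, hNP⟩ := noPat ε (μ' / 12) hε (by positivity)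
  refine ⟨min ν0 (μ' / 4), lt_min hν0 (by positivity), fun t => ?_⟩
  obtain ⟨s2, hs2⟩ := ramsey2 (κ := Prop) (max t 3)
  obtain ⟨s, hs⟩ := ramsey3 (κ := Prop × Prop × Prop × Prop × Prop × Prop) (s2 + n)
  refine ⟨s, ?_⟩
  intro A J hA hJ hJs Φ Ψ Ω hΦ hΨ hΩ dΦ dΩ
  set ν := min ν0 (μ' / 4) with hν
  have hν1 : ν ≤ ν0 := min_le_left _ _
  have hν2 : ν ≤ μ' / 4 := min_le_right _ _
  set p := pat A (μ' / 12) with hp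
  obtain ⟨J1, hJ1, hJ1c, c, hc⟩ := hs J hJs (fun i j k => (p Φ Φ Ω i j k, p Φ Ω Φ i j k,
    p Ω Φ Φ i j k, p Ω Ω Φ i j k, p Ω Φ Ω i j k, p Φ Ω Ω i j k))
  obtain ⟨c1, c2, c3, c4, c5, c6⟩ := c
  simp only [Prod.mk.injEq] at hc
  have hΦ1 := IsHoleW.mono hΦ hν1 hJ1
  have hΨ1 := IsHoleW.mono hΨ hν1 hJ1
  have hΩ1 := IsHoleW.mono hΩ hν1 hJ1
  have dΦ1 : A.HolesDisjoint ε J1 Φ Ψ := fun i hi j hj => dΦ i (hJ1 hi) j (hJ1 hj)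
  have dΩ1 : A.HolesDisjoint ε J1 Ω Ψ := fun i hi j hj => dΩ i (hJ1 hi) j (hJ1 hj)
  have hJ1I := hJ1.trans hJ
  obtain ⟨q1, q2, q3⟩ := hNP A J1 hA hJ1I (by omega) Φ Ω Ψ hΦ1 hΩ1 hΨ1 dΦ1 dΩ1
  obtain ⟨q4, q5, q6⟩ := hNP A J1 hA hJ1I (by omega) Ω Φ Ψ hΩ1 hΦ1 hΨ1 dΩ1 dΦ1
  have n1 : ¬ c1 := fun h => q1 fun i hi j hj k hk a b => by
    have := (hc i hi j hj k hk a b).1; rw [← this] at h; exact h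
  have n2 : ¬ c2 := fun h => q2 fun i hi j hj k hk a b => by
    have := (hc i hi j hj k hk a b).2.1; rw [← this] at h; exact h
  have n3 : ¬ c3 := fun h => q3 fun i hi j hj k hk a b => by
    have := (hc i hi j hj k hk a b).2.2.1; rw [← this] at h; exact h
  have n4 : ¬ c4 := fun h => q4 fun i hi j hj k hk a b => by
    have := (hc i hi j hj k hk a b).2.2.2.1; rw [← this] at h; exact h
  have n5 : ¬ c5 := fun h => q5 fun i hi j hj k hk a b => by
    have := (hc i hi j hj k hk a b).2.2.2.2.1; rw [← this] at h; exact h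
  have n6 : ¬ c6 := fun h => q6 fun i hi j hj k hk a b => by
    have := (hc i hi j hj k hk a b).2.2.2.2.2; rw [← this] at h; exact h
  have hole1 : ∀ i ∈ J1, ∀ j ∈ J1, ∀ k ∈ J1, i < j → j < k →
      (A.ecount ((Φ ∪ Ω) ∩ A.P i j) ((Φ ∪ Ω) ∩ A.P i k) ((Φ ∪ Ω) ∩ A.P j k) : ℝ) ≤
        μ' * (((A.P i j).card : ℝ) * ((A.P i k).card : ℝ) * ((A.P j k).card : ℝ)) := by
    intro i hi j hj k hk hij hjk
    obtain ⟨e1, e2, e3, e4, e5, e6⟩ := hc i hi j hj k hk hij hjk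
    rw [← e1] at n1
    rw [← e2] at n2
    rw [← e3] at n3
    rw [← e4] at n4
    rw [← e5] at n5
    rw [← e6] at n6
    simp only [hp, pat, not_le] at n1 n2 n3 n4 n5 n6
    have f1 := hΦ.1.2 i (hJ1 hi) j (hJ1 hj) k (hJ1 hk) hij.ne (hij.trans hjk).ne hjk.ne
    have f2 := hΩ.1.2 i (hJ1 hi) j (hJ1 hj) k (hJ1 hk) hij.ne (hij.trans hjk).ne hjk.ne
    simp only [Finset.union_inter_distrib_right]
    have g := ecount_union8 A (Φ ∩ A.P i j) (Ω ∩ A.P i j) (Φ ∩ A.P i k) (Ω ∩ A.P i k)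
      (Φ ∩ A.P j k) (Ω ∩ A.P j k)
    have g' := (Nat.cast_le (α := ℝ)).2 g
    push_cast at g'
    set prd := (((A.P i j).card : ℝ) * ((A.P i k).card : ℝ) * ((A.P j k).card : ℝ)) with hprd
    have hprd0 : 0 ≤ prd := by positivity
    have f3 : ν * prd ≤ μ' / 4 * prd := mul_le_mul_of_nonneg_right hν2 hprd0
    linarith
  have hole2 := hole_sorted A μ' J1 (Φ ∪ Ω) hole1
  obtain ⟨J2, hJ2, hJ2c, c, hc⟩ := hs2 J1 (by omega) (fun i j =>
    (((Φ ∪ Ω) ∩ Ψ ∩ A.P i j).card : ℝ) < ε * ((A.P i j).card : ℝ))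
  have hJ2J := hJ2.trans hJ1
  by_cases hcc : c
  · refine ⟨J2, hJ2J, le_trans (le_max_left _ _) hJ2c, ⟨⟨?_, ?_⟩, ?_⟩, ?_⟩
    · intro i hi j hj hij
      exact (hΦ.1.1 i (hJ2J hi) j (hJ2J hj) hij).mono
        (Finset.inter_subset_inter_right Finset.subset_union_left)
    · intro i hi j hj k hk h1 h2 h3
      exact (hole2 i (hJ2 hi) j (hJ2 hj) k (hJ2 hk) h1 h2 h3).trans
        (mul_le_mul_of_nonneg_right hμ'1 (by positivity))
    · intro i hi j hj hij
      refine (hΦ.2 i (hJ2J hi) j (hJ2J hj) hij).trans ?_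
      exact_mod_cast Finset.card_le_card
        (Finset.inter_subset_inter_right Finset.subset_union_left)
    · intro i hi j hj hij
      rcases lt_or_gt_of_ne hij with h | h
      · rw [hc i hi j hj h]; exact hcc
      · rw [A.Psymm i j, hc j hj i hi h]; exact hcc
  · exfalso
    have hbig : ∀ i ∈ J2, ∀ j ∈ J2, i < j →
        ε * ((A.P i j).card : ℝ) ≤ (((Φ ∪ Ω) ∩ Ψ ∩ A.P i j).card : ℝ) := by
      intro i hi j hj hij
      rw [← hc i hi j hj hij] at hcc
      exact not_lt.1 hcc
    obtain ⟨B, hB, C, hC, D, hD, cB, cC, cD, hBC, hBD, hCD⟩ := blocks 1 1 1 J2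
      (by have := le_trans (le_max_right t 3) hJ2c; omega)
    obtain ⟨i, hi⟩ := Finset.card_pos.1 (by omega : 0 < B.card)
    obtain ⟨j, hj⟩ := Finset.card_pos.1 (by omega : 0 < C.card)
    obtain ⟨k, hk⟩ := Finset.card_pos.1 (by omega : 0 < D.card)
    have hij := hBC i hi j hj
    have hik := hBD i hi k hk
    have hjk := hCD j hj k hk
    replace hi := hB hi
    replace hj := hC hj
    replace hk := hD hk
    have hiI := hJ (hJ2J hi)
    have hjI := hJ (hJ2J hj)
    have hkI := hJ (hJ2J hk)
    set X := (Φ ∪ Ω) ∩ Ψ ∩ A.P i j with hX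
    set Y := (Φ ∪ Ω) ∩ Ψ ∩ A.P i k with hY
    have bX := hbig i hi j hj hij
    have bY := hbig i hi k hk hik
    have p1 := Ppos A hiI hjI hij.ne
    have p2 := Ppos A hiI hkI hik.ne
    have p3 := Ppos A hjI hkI hjk.ne
    have low : (X.card : ℝ) * Y.card * (2 * ε * ((A.P j k).card : ℝ)) ≤
        (A.ecount X Y ((Φ ∪ Ω) ∩ A.P j k) : ℝ) + (A.ecount X Y (Ψ ∩ A.P j k) : ℝ) := by
      rw [ecount_eq, ecount_eq, ← Finset.sum_add_distrib]
      have := Finset.card_nsmul_le_sum (X ×ˢ Y)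
        (fun p => ((((Φ ∪ Ω) ∩ A.P j k).filter (fun z => A.Edge p.1 p.2 z)).card : ℝ) +
          (((Ψ ∩ A.P j k).filter (fun z => A.Edge p.1 p.2 z)).card : ℝ))
        (2 * ε * ((A.P j k).card : ℝ)) (by
          rintro ⟨x, y⟩ hxy
          obtain ⟨hx, hy⟩ := Finset.mem_product.1 hxy
          have hx' : x ∈ A.P i j := (Finset.mem_inter.1 hx).2
          have hy' : y ∈ A.P i k := (Finset.mem_inter.1 hy).2
          have dg := hA.1 i j k hiI hjI hkI hij.ne hik.ne hjk.ne x hx' y hy'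
          have tm := two_meet (A.P j k) Φ Ψ (A.nbhd j k x y) ε (nbhd_sub A _ _ _ _) dg
            (hΦ.2 j (hJ2J hj) k (hJ2J hk) hjk.ne) (hΨ.2 j (hJ2J hj) k (hJ2J hk) hjk.ne)
            (dΦ j (hJ2J hj) k (hJ2J hk) hjk.ne)
          rw [filter_inter_eq, filter_inter_eq]
          have mo : ((A.nbhd j k x y ∩ Φ).card : ℝ) ≤ ((A.nbhd j k x y ∩ (Φ ∪ Ω)).card : ℝ) := by
            exact_mod_cast Finset.card_le_card
              (Finset.inter_subset_inter_left Finset.subset_union_left)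
          linarith)
      rw [nsmul_eq_mul, Finset.card_product] at this
      push_cast at this
      exact this
    have up1 : (A.ecount X Y ((Φ ∪ Ω) ∩ A.P j k) : ℝ) ≤
        μ' * (((A.P i j).card : ℝ) * ((A.P i k).card : ℝ) * ((A.P j k).card : ℝ)) := by
      refine le_trans ?_ (hole1 i (hJ2 hi) j (hJ2 hj) k (hJ2 hk) hij hjk)
      exact_mod_cast ecount_mono A
        (Finset.inter_subset_inter_right Finset.inter_subset_left)
        (Finset.inter_subset_inter_right Finset.inter_subset_left) (Finset.Subset.refl _)
    have up2 : (A.ecount X Y (Ψ ∩ A.P j k) : ℝ) ≤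
        ν * (((A.P i j).card : ℝ) * ((A.P i k).card : ℝ) * ((A.P j k).card : ℝ)) := by
      refine le_trans ?_ (hΨ.1.2 i (hJ2J hi) j (hJ2J hj) k (hJ2J hk) hij.ne hik.ne hjk.ne)
      exact_mod_cast ecount_mono A
        (Finset.inter_subset_inter_right Finset.inter_subset_right)
        (Finset.inter_subset_inter_right Finset.inter_subset_right) (Finset.Subset.refl _)
    have lo2 : (ε * ((A.P i j).card : ℝ)) * (ε * ((A.P i k).card : ℝ)) *
        (2 * ε * ((A.P j k).card : ℝ)) ≤ (X.card : ℝ) * Y.card * (2 * ε * ((A.P j k).card : ℝ)) := by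
      gcongr
    have hprd0 : 0 < (((A.P i j).card : ℝ) * ((A.P i k).card : ℝ) * ((A.P j k).card : ℝ)) := by
      positivity
    set prd := (((A.P i j).card : ℝ) * ((A.P i k).card : ℝ) * ((A.P j k).card : ℝ)) with hprd
    have e : (ε * ((A.P i j).card : ℝ)) * (ε * ((A.P i k).card : ℝ)) *
        (2 * ε * ((A.P j k).card : ℝ)) = 2 * ε ^ 3 * prd := by rw [hprd]; ring
    have f1 : ν * prd ≤ μ' / 4 * prd := mul_le_mul_of_nonneg_right hν2 hprd0.le
    have f2 : μ' * prd ≤ ε ^ 3 * prd := mul_le_mul_of_nonneg_right hμ'2 hprd0.le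
    have f3 : 0 < ε ^ 3 * prd := by positivity
    linarith

lemma disj_comm {A : ReducedHG} {ε : ℝ} {J X Y : Finset ℕ} (h : A.HolesDisjoint ε J X Y) :
    A.HolesDisjoint ε J Y X := by
  intro i hi j hj hij
  rw [Finset.inter_comm Y X]
  exact h i hi j hj hij

lemma disj_sorted {A : ReducedHG} {ε : ℝ} {J X Y : Finset ℕ}
    (h : ∀ i ∈ J, ∀ j ∈ J, i < j →
      ((X ∩ Y ∩ A.P i j).card : ℝ) < ε * ((A.P i j).card : ℝ)) : A.HolesDisjoint ε J X Y := by
  intro i hi j hj hij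
  rcases lt_or_gt_of_ne hij with h' | h'
  · exact h i hi j hj h'
  · rw [A.Psymm i j]; exact h j hj i hi h'

theorem main_aux :
    ∀ μ ε : ℝ, 0 < μ → 0 < ε → ∃ ν : ℝ, 0 < ν ∧ ∀ t : ℕ, ∃ s : ℕ,
      ∀ (A : ReducedHG) (J : Finset ℕ), A.Wicked ε → J ⊆ A.I → s ≤ J.card →
        ∀ Φ Ψ Ω : Finset ℕ,
          A.IsHoleW ν (1/3 + ε) J Φ → A.IsHoleW ν (1/3 + ε) J Ψ →
          A.IsHoleW ν (1/3 + ε) J Ω →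
          A.HolesDisjoint ε J Φ Ψ →
          ∃ Js ⊆ J, t ≤ Js.card ∧
            ((A.IsHoleW μ (1/3 + ε) Js (Φ ∪ Ω) ∧ A.HolesDisjoint ε Js (Φ ∪ Ω) Ψ) ∨
             (A.IsHoleW μ (1/3 + ε) Js (Ψ ∪ Ω) ∧ A.HolesDisjoint ε Js (Ψ ∪ Ω) Φ)) := by
  intro μ ε hμ hε
  obtain ⟨n1, ν1, hν1, h1⟩ := lemU1 ε hε
  obtain ⟨ν2, hν2, h2⟩ := branch μ ε hμ hε
  refine ⟨min ν1 ν2, lt_min hν1 hν2, fun t => ?_⟩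
  obtain ⟨s2, hs2⟩ := h2 t
  obtain ⟨s, hs⟩ := ramsey2 (κ := Prop × Prop) (n1 + s2)
  refine ⟨s, ?_⟩
  intro A J hA hJ hJs Φ Ψ Ω hΦ hΨ hΩ hd
  obtain ⟨J1, hJ1, hJ1c, ⟨c1, c2⟩, hc⟩ := hs J hJs (fun i j =>
    (((Φ ∩ Ω ∩ A.P i j).card : ℝ) < ε * ((A.P i j).card : ℝ),
      ((Ψ ∩ Ω ∩ A.P i j).card : ℝ) < ε * ((A.P i j).card : ℝ)))
  simp only [Prod.mk.injEq] at hc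
  have hJ1I := hJ1.trans hJ
  have hd1 : A.HolesDisjoint ε J1 Φ Ψ := fun i hi j hj => hd i (hJ1 hi) j (hJ1 hj)
  by_cases hc2 : c2
  · have dd : A.HolesDisjoint ε J1 Ψ Ω := disj_sorted fun i hi j hj hij => by
      rw [(hc i hi j hj hij).2]; exact hc2
    obtain ⟨Js, a, b, c, d⟩ := hs2 A J1 hA hJ1I (by omega) Φ Ψ Ω
      (IsHoleW.mono hΦ (min_le_right _ _) hJ1) (IsHoleW.mono hΨ (min_le_right _ _) hJ1)
      (IsHoleW.mono hΩ (min_le_right _ _) hJ1) hd1 (disj_comm dd)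
    exact ⟨Js, a.trans hJ1, b, Or.inl ⟨c, d⟩⟩
  by_cases hc1 : c1
  · have dd : A.HolesDisjoint ε J1 Φ Ω := disj_sorted fun i hi j hj hij => by
      rw [(hc i hi j hj hij).1]; exact hc1
    obtain ⟨Js, a, b, c, d⟩ := hs2 A J1 hA hJ1I (by omega) Ψ Φ Ω
      (IsHoleW.mono hΨ (min_le_right _ _) hJ1) (IsHoleW.mono hΦ (min_le_right _ _) hJ1)
      (IsHoleW.mono hΩ (min_le_right _ _) hJ1) (disj_comm hd1) (disj_comm dd)
    exact ⟨Js, a.trans hJ1, b, Or.inr ⟨c, d⟩⟩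
  exfalso
  refine h1 A J1 hA hJ1I (by omega) Φ Ψ Ω
      (IsHoleW.mono hΦ (min_le_left _ _) hJ1) (IsHoleW.mono hΨ (min_le_left _ _) hJ1)
      (IsHoleW.mono hΩ (min_le_left _ _) hJ1) hd1 ?_ ?_
  · intro i hi j hj hij
    have := (hc i hi j hj hij).1
    rw [← this] at hc1
    exact not_lt.1 hc1
  · intro i hi j hj hij
    have := (hc i hi j hj hij).2
    rw [← this] at hc2
    exact not_lt.1 hc2

end AU



/-- Corollary (`cor:adhoc`): given `(ν, 1/3+ε)`-holes `Φ`, `Ψ`, `Ω` with `Φ`, `Ψ`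
`ε`-disjoint in an `ε`-wicked reduced hypergraph, on a large subset `J⋆` either
`Φ ∪ Ω` is a `(μ, 1/3+ε)`-hole that is `ε`-disjoint from `Ψ`, or `Ψ ∪ Ω` is a
`(μ, 1/3+ε)`-hole that is `ε`-disjoint from `Φ`. -/
theorem adhoc_union :
    ∀ μ ε : ℝ, 0 < μ → 0 < ε → ∃ ν : ℝ, 0 < ν ∧ ∀ t : ℕ, ∃ s : ℕ,
      ∀ (A : ReducedHG) (J : Finset ℕ), A.Wicked ε → J ⊆ A.I → s ≤ J.card →
        ∀ Φ Ψ Ω : Finset ℕ,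
          A.IsHoleW ν (1/3 + ε) J Φ → A.IsHoleW ν (1/3 + ε) J Ψ →
          A.IsHoleW ν (1/3 + ε) J Ω →
          A.HolesDisjoint ε J Φ Ψ →
          ∃ Js ⊆ J, t ≤ Js.card ∧
            ((A.IsHoleW μ (1/3 + ε) Js (Φ ∪ Ω) ∧ A.HolesDisjoint ε Js (Φ ∪ Ω) Ψ) ∨
             (A.IsHoleW μ (1/3 + ε) Js (Ψ ∪ Ω) ∧ A.HolesDisjoint ε Js (Ψ ∪ Ω) Φ)) := by
  exact AU.main_aux
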